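/- arXiv:math/0701038 — 2 statements merged into one kernel-verified Lean document; each statement's English description precedes it below -/
import Mathlib

section
/- The complexes N_5 and N_6 are bistellar equivalent: N_6 can be obtained from N_5 (up to isomorphism) by a finite sequence of bistellar moves, including 0-moves and 3-moves. -/
/-! Basic framework for finite simplicial complexes, pseudomanifolds and
bistellar moves, following Datta–Nilakantan. A complex is recorded as the
finite set of its faces (nonempty finite subsets of the vertex type). -/

namespace NPM

variable {α β : Type*} [DecidableEq α] [DecidableEq β]

/-- A "complex" datum: a finite family of finite subsets of `α`. -/
abbrev Complex (α : Type*) := Finset (Finset α)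

/-- `K` is a simplicial complex: a nonempty collection of nonempty sets,
closed under passing to nonempty subsets. -/
def IsComplex (K : Complex α) : Prop :=
  K.Nonempty ∧ (∀ σ ∈ K, σ.Nonempty) ∧ ∀ σ ∈ K, ∀ τ ⊆ σ, τ.Nonempty → τ ∈ K

/-- The vertex set of `K`. -/
def verts (K : Complex α) : Finset α := K.sup id

/-- `K` is pure of dimension `d`: every face is contained in a face with
`d+1` vertices. -/
def IsPure (K : Complex α) (d : ℕ) : Prop :=
  ∀ σ ∈ K, ∃ τ ∈ K, σ ⊆ τ ∧ τ.card = d + 1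

/-- The facets ("`d`-faces") of a pure `d`-dimensional complex. -/
def facets (K : Complex α) (d : ℕ) : Complex α := K.filter (fun σ => σ.card = d + 1)

/-- The link of a face `σ` in `K`. -/
def link (K : Complex α) (σ : Finset α) : Complex α :=
  K.filter (fun τ => Disjoint τ σ ∧ σ ∪ τ ∈ K)

/-- The degree of a face: the number of vertices of its link. -/
def degree (K : Complex α) (σ : Finset α) : ℕ := (verts (link K σ)).card

/-- A weak `d`-pseudomanifold: a pure `d`-dimensional complex in which every
`(d-1)`-face (i.e. face with `d` vertices) lies in exactly two facets. -/
def WeakPM (K : Complex α) (d : ℕ) : Prop :=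
  IsComplex K ∧ IsPure K d ∧
    ∀ σ ∈ K, σ.card = d → (K.filter fun τ => σ ⊆ τ ∧ τ.card = d + 1).card = 2

/-- Strong connectedness: any two facets are joined by a chain of facets in
which consecutive facets meet in a `(d-1)`-face. -/
def SConn (K : Complex α) (d : ℕ) : Prop :=
  ∀ σ ∈ facets K d, ∀ τ ∈ facets K d,
    Relation.ReflTransGen
      (fun a b => a ∈ facets K d ∧ b ∈ facets K d ∧ (a ∩ b).card = d) σ τ

/-- A `d`-pseudomanifold: a strongly connected weak `d`-pseudomanifold. -/
def IsPM (K : Complex α) (d : ℕ) : Prop := WeakPM K d ∧ SConn K d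

/-- Connectedness of a complex: the graph of vertices and edges is connected. -/
def Conn (K : Complex α) : Prop :=
  (verts K).Nonempty ∧ ∀ u ∈ verts K, ∀ v ∈ verts K,
    Relation.ReflTransGen (fun a b => a ≠ b ∧ ({a, b} : Finset α) ∈ K) u v

/-- A normal `d`-pseudomanifold: a connected weak `d`-pseudomanifold in which
the link of every face of dimension `≤ d - 2` is connected. -/
def NormalPM (K : Complex α) (d : ℕ) : Prop :=
  WeakPM K d ∧ Conn K ∧ ∀ σ ∈ K, σ.card + 1 ≤ d → Conn (link K σ)

/-- `K` is neighbourly: every pair of vertices forms an edge. -/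
def Neighbourly (K : Complex α) : Prop :=
  ∀ u ∈ verts K, ∀ v ∈ verts K, u ≠ v → ({u, v} : Finset α) ∈ K

/-- Isomorphism of complexes: a map injective on the vertex set carrying the
faces of `K` exactly onto the faces of `L`. -/
def Iso (K : Complex α) (L : Complex β) : Prop :=
  ∃ f : α → β, Set.InjOn f ↑(verts K) ∧ L = K.image (fun σ => σ.image f)

/-- The complex generated by a family of facets: all nonempty subsets. -/
def genCx (F : Finset (Finset α)) : Complex α :=
  F.biUnion fun σ => σ.powerset.filter (fun τ => τ.Nonempty)

/-- The standard sphere on the vertex set `B`: all nonempty proper subsets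
of `B`. -/
def stdSphere (B : Finset α) : Complex α :=
  B.powerset.filter fun τ => τ.Nonempty ∧ τ ≠ B

/-- In a weak `d`-pseudomanifold, a removable `(d-i)`-face `A`: its link is a
standard sphere `S^{i-1}_{i+1}(B)` with `B` not a face.  (For `d = 3`,
`i = 1` gives removable 2-faces and `i = 2` gives removable 1-faces.) -/
def RemovableFace (d i : ℕ) (K : Complex α) (A : Finset α) : Prop :=
  A ∈ K ∧ A.card = d - i + 1 ∧
    ∃ B : Finset α, B.card = i + 1 ∧ B ∉ K ∧ link K A = stdSphere B

/-- The bistellar `i`-move (`0 < i ≤ d`) relation on weak `d`-pseudomanifolds: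
`L` is obtained from `K` by removing a removable `(d-i)`-face `A` with
`link K A = stdSphere B` and inserting the facets `(B ∪ A) \ {v}`, `v ∈ A`. -/
def BMove (d i : ℕ) (K L : Complex α) : Prop :=
  ∃ A B : Finset α, A ∈ K ∧ A.card = d - i + 1 ∧ B.card = i + 1 ∧ B ∉ K ∧
    link K A = stdSphere B ∧
    L = genCx ((facets K d).filter (fun σ => ¬ A ⊆ σ) ∪
          A.image fun v => (B ∪ A).erase v)

/-- The bistellar `0`-move: star a new vertex `w` in a facet `σ`. -/
def BMove0 (d : ℕ) (K L : Complex α) : Prop :=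
  ∃ σ w, σ ∈ K ∧ σ.card = d + 1 ∧ w ∉ verts K ∧
    L = genCx (((facets K d).erase σ) ∪ σ.image fun v => insert w (σ.erase v))

/-- A single bistellar move of any type `0 ≤ i ≤ d`. -/
def BStep (d : ℕ) (K L : Complex α) : Prop :=
  BMove0 d K L ∨ ∃ i, 0 < i ∧ i ≤ d ∧ BMove d i K L

/-- Bistellar equivalence: a finite sequence of bistellar moves. -/
def BEquiv (d : ℕ) : Complex α → Complex α → Prop :=
  Relation.ReflTransGen (BStep d)

/-- A proper bistellar move: a bistellar `i`-move with `0 < i < d`. -/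
def PMove (d : ℕ) (K L : Complex α) : Prop := ∃ i, 0 < i ∧ i < d ∧ BMove d i K L

/-- Proper bistellar equivalence. -/
def PEquiv (d : ℕ) : Complex α → Complex α → Prop :=
  Relation.ReflTransGen (PMove d)

/-- The result of the bistellar move on the face `A` of the weak
`d`-pseudomanifold `K` (deterministic form: `B` is the vertex set of
`link K A`). -/
def kappa (d : ℕ) (K : Complex α) (A : Finset α) : Complex α :=
  genCx ((facets K d).filter (fun σ => ¬ A ⊆ σ) ∪
    A.image fun v => (verts (link K A) ∪ A).erase v)

/-- A cycle: a (finite) 1-pseudomanifold. -/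
def Cycle (K : Complex α) : Prop := IsPM K 1

/-- A combinatorial 2-manifold: a weak 2-pseudomanifold all whose vertex
links are cycles. -/
def Comb2Mfd (K : Complex α) : Prop :=
  WeakPM K 2 ∧ ∀ v, ({v} : Finset α) ∈ K → Cycle (link K {v})

/-- The Euler characteristic `f₀ - f₁ + f₂` of a 2-dimensional complex. -/
def eulerChar (K : Complex α) : ℤ :=
  ((K.filter fun σ => σ.card = 1).card : ℤ) -
    ((K.filter fun σ => σ.card = 2).card : ℤ) +
    ((K.filter fun σ => σ.card = 3).card : ℤ)

/-- A combinatorial 2-sphere: a connected combinatorial 2-manifold with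
Euler characteristic 2. -/
def Comb2Sphere (K : Complex α) : Prop := Comb2Mfd K ∧ Conn K ∧ eulerChar K = 2

/-- A combinatorial 3-manifold: a 3-pseudomanifold all whose vertex links are
combinatorial 2-spheres. -/
def Comb3Mfd (K : Complex α) : Prop :=
  IsPM K 3 ∧ ∀ v, ({v} : Finset α) ∈ K → Comb2Sphere (link K {v})

end NPM

/-- The complex `N5` from the paper, generated by its facets. -/
def N5 : NPM.Complex ℕ :=
  NPM.genCx {{1,2,5,8}, {1,2,6,8}, {1,3,5,8}, {1,3,7,8}, {1,4,6,8}, {1,4,7,8}, {2,3,6,8}, {2,3,7,8}, {2,4,5,8}, {2,4,7,8}, {3,4,5,8}, {3,4,6,8}, {1,2,5,7}, {1,2,6,7}, {1,3,6,7}, {1,4,5,7}, {2,3,5,7}, {2,4,6,7}, {3,4,5,7}, {3,4,6,7}, {2,3,5,6}, {2,4,5,6}, {1,3,5,6}, {1,4,5,6}}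
/-- The complex `N6` from the paper, generated by its facets. -/
def N6 : NPM.Complex ℕ :=
  NPM.genCx {{1,3,5,8}, {1,3,7,8}, {1,4,6,8}, {1,4,7,8}, {1,5,6,8}, {2,3,6,8}, {2,3,7,8}, {2,4,5,8}, {2,4,7,8}, {2,5,6,8}, {3,4,5,8}, {3,4,6,8}, {1,2,3,5}, {1,2,4,5}, {1,4,5,7}, {1,5,6,7}, {2,3,5,7}, {2,5,6,7}, {3,4,5,7}, {1,2,3,6}, {1,2,4,6}, {1,3,6,7}, {2,4,6,7}, {3,4,6,7}}

namespace NPM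

section Flip

variable {α : Type*} [DecidableEq α]

lemma mem_genCx {F : Finset (Finset α)} {τ : Finset α} :
    τ ∈ genCx F ↔ τ.Nonempty ∧ ∃ σ ∈ F, τ ⊆ σ := by
  simp only [genCx, Finset.mem_biUnion, Finset.mem_filter, Finset.mem_powerset]
  tauto

lemma genCx_image {β : Type*} [DecidableEq β] (F : Finset (Finset α)) (f : α → β) :
    (genCx F).image (fun σ => σ.image f) = genCx (F.image fun σ => σ.image f) := by
  ext τ
  simp only [Finset.mem_image, mem_genCx]
  constructor
  · rintro ⟨ρ, ⟨hρ, σ, hσ, hρσ⟩, rfl⟩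
    exact ⟨hρ.image f, _, ⟨σ, hσ, rfl⟩, Finset.image_subset_image hρσ⟩
  · rintro ⟨hτ, _, ⟨σ, hσ, rfl⟩, hτσ⟩
    obtain ⟨ρ, hρσ, rfl⟩ := Finset.subset_image_iff.1 hτσ
    exact ⟨ρ, ⟨Finset.image_nonempty.1 hτ, σ, hσ, by exact_mod_cast hρσ⟩, rfl⟩

lemma facets_genCx {d : ℕ} {F : Finset (Finset α)} (hF : ∀ σ ∈ F, σ.card = d + 1) :
    facets (genCx F) d = F := by
  ext τ
  simp only [facets, Finset.mem_filter, mem_genCx]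
  constructor
  · rintro ⟨⟨-, σ, hσ, hτσ⟩, hτ⟩
    rwa [Finset.eq_of_subset_of_card_le hτσ (by rw [hF σ hσ, hτ])]
  · exact fun hτ => ⟨⟨Finset.card_pos.1 (by rw [hF τ hτ]; omega), τ, hτ, subset_rfl⟩, hF τ hτ⟩

/-- The family of facets obtained from `F` by the bistellar move replacing the star of `A`
by the join of `B` with the boundary of `A`. -/
def flip (F : Finset (Finset α)) (A B : Finset α) : Finset (Finset α) :=
  F.filter (fun σ => ¬ A ⊆ σ) ∪ A.image fun v => (B ∪ A).erase v

/-- The conditions, in terms of facets only, under which the bistellar move on `A` with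
link `stdSphere B` is available. For `B` a singleton this describes a bistellar `0`-move. -/
abbrev Flippable (d : ℕ) (F : Finset (Finset α)) (A B : Finset α) : Prop :=
  A.Nonempty ∧ B.Nonempty ∧ Disjoint A B ∧ A.card + B.card = d + 2 ∧ (∀ σ ∈ F, ¬ B ⊆ σ) ∧
    F.filter (fun σ => A ⊆ σ) = B.image fun v => (B ∪ A).erase v

lemma Flippable.mem_star {d : ℕ} {F : Finset (Finset α)} {A B : Finset α}
    (h : Flippable d F A B) {σ : Finset α} :
    σ ∈ F ∧ A ⊆ σ ↔ ∃ v ∈ B, (B ∪ A).erase v = σ := by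
  simpa using Finset.ext_iff.1 h.2.2.2.2.2 σ

lemma Flippable.mem_genCx {d : ℕ} {F : Finset (Finset α)} {A B : Finset α}
    (h : Flippable d F A B) : A ∈ genCx F := by
  obtain ⟨v, hv⟩ := h.2.1
  have := h.mem_star.2 ⟨v, hv, rfl⟩
  exact NPM.mem_genCx.2 ⟨h.1, _, this⟩

lemma Flippable.link_genCx {d : ℕ} {F : Finset (Finset α)} {A B : Finset α}
    (h : Flippable d F A B) : link (genCx F) A = stdSphere B := by
  have hAB := h.2.2.1
  ext τ
  simp only [link, stdSphere, Finset.mem_filter, Finset.mem_powerset, NPM.mem_genCx]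
  constructor
  · rintro ⟨⟨hτ, -⟩, hτA, -, σ, hσ, hsub⟩
    obtain ⟨v, hv, rfl⟩ := h.mem_star.1 ⟨hσ, Finset.union_subset_left hsub⟩
    have hsub' := Finset.union_subset_right hsub
    refine ⟨fun x hx => ?_, hτ, ?_⟩
    · have := Finset.mem_of_mem_erase (hsub' hx)
      exact (Finset.mem_union.1 this).resolve_right (Finset.disjoint_left.1 hτA hx)
    · rintro rfl
      exact Finset.notMem_erase _ _ (hsub' hv)
  · rintro ⟨hτB, hτ, hne⟩
    obtain ⟨v, hv, hvτ⟩ := Finset.exists_of_ssubset (hτB.ssubset_of_ne hne)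
    obtain ⟨hF, hA⟩ := h.mem_star.2 ⟨v, hv, rfl⟩
    have hsub : τ ⊆ (B ∪ A).erase v := fun x hx =>
      Finset.mem_erase.2 ⟨fun e => hvτ (e ▸ hx), Finset.mem_union_left _ (hτB hx)⟩
    exact ⟨⟨hτ, _, hF, hsub⟩, (hAB.mono_right hτB).symm, h.1.mono Finset.subset_union_left,
      _, hF, Finset.union_subset hA hsub⟩

lemma Flippable.bStep {d : ℕ} {F : Finset (Finset α)} {A B : Finset α}
    (h : Flippable d F A B) (hF : ∀ σ ∈ F, σ.card = d + 1) :
    BStep d (genCx F) (genCx (flip F A B)) := by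
  have hmem := h.mem_genCx
  obtain ⟨hA, hB, hAB, hcard, hBF, -⟩ := id h
  have hA' := hA.card_pos
  have hB' := hB.card_pos
  by_cases hB1 : B.card = 1
  · obtain ⟨w, rfl⟩ := Finset.card_eq_one.1 hB1
    have hAc : A.card = d + 1 := by omega
    have hwA : w ∉ A := Finset.disjoint_singleton_right.1 hAB
    refine Or.inl ⟨A, w, hmem, hAc, ?_, ?_⟩
    · simp only [verts, Finset.mem_sup, NPM.mem_genCx, id, not_exists, not_and]
      rintro τ ⟨-, σ, hσ, hτσ⟩ hw
      exact hBF σ hσ (Finset.singleton_subset_iff.2 (hτσ hw))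
    · rw [facets_genCx hF, flip]
      congr 2
      · ext σ
        simp only [Finset.mem_filter, Finset.mem_erase]
        refine ⟨fun ⟨hσ, hAσ⟩ => ⟨fun e => hAσ e.ge, hσ⟩, fun ⟨hne, hσ⟩ => ⟨hσ, fun hAσ => hne ?_⟩⟩
        exact (Finset.eq_of_subset_of_card_le hAσ (by rw [hF σ hσ, hAc])).symm
      · refine Finset.image_congr fun v hv => ?_
        have : w ≠ v := fun e => hwA (e ▸ hv)
        rw [← Finset.insert_eq, Finset.erase_insert_of_ne this]
  · refine Or.inr ⟨B.card - 1, by omega, by omega, A, B, hmem, by omega, by omega, ?_,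
      h.link_genCx, ?_⟩
    · rintro hBK
      obtain ⟨-, σ, hσ, hsub⟩ := NPM.mem_genCx.1 hBK
      exact hBF σ hσ hsub
    · rw [facets_genCx hF, flip]

lemma Flippable.card_of_mem_flip {d : ℕ} {F : Finset (Finset α)} {A B : Finset α}
    (h : Flippable d F A B) (hF : ∀ σ ∈ F, σ.card = d + 1) :
    ∀ σ ∈ flip F A B, σ.card = d + 1 := by
  intro σ hσ
  simp only [flip, Finset.mem_union, Finset.mem_filter, Finset.mem_image] at hσ
  obtain hσ | ⟨v, hv, rfl⟩ := hσ
  · exact hF σ hσ.1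
  · have := h.2.2.2.1
    rw [Finset.card_erase_of_mem (Finset.mem_union_right _ hv),
      Finset.card_union_of_disjoint h.2.2.1.symm]
    omega

/-- The family of facets resulting from a list of successive moves. -/
def flips (F : Finset (Finset α)) : List (Finset α × Finset α) → Finset (Finset α)
  | [] => F
  | (A, B) :: l => flips (flip F A B) l

/-- Every move in the list is available when its turn comes. -/
def AllFlippable (d : ℕ) (F : Finset (Finset α)) : List (Finset α × Finset α) → Prop
  | [] => True
  | (A, B) :: l => Flippable d F A B ∧ AllFlippable d (flip F A B) l

instance AllFlippable.decidable (d : ℕ) (F : Finset (Finset α)) :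
    (l : List (Finset α × Finset α)) → Decidable (AllFlippable d F l)
  | [] => .isTrue trivial
  | (A, B) :: l =>
    have := AllFlippable.decidable d (flip F A B) l
    inferInstanceAs (Decidable (Flippable d F A B ∧ AllFlippable d (flip F A B) l))

lemma AllFlippable.bEquiv {d : ℕ} {l : List (Finset α × Finset α)} {F : Finset (Finset α)}
    (h : AllFlippable d F l) (hF : ∀ σ ∈ F, σ.card = d + 1) :
    BEquiv d (genCx F) (genCx (flips F l)) := by
  induction l generalizing F with
  | nil => exact Relation.ReflTransGen.refl
  | cons p l ih =>
    exact Relation.ReflTransGen.head (h.1.bStep hF) (ih h.2 (h.1.card_of_mem_flip hF))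

end Flip

/-- A sequence of bistellar moves from `N5` to a copy of `N6`: a `0`-move introducing the
vertex `9`, followed by proper moves, and a `3`-move removing `9` again. -/
def movesN5N6 : List (Finset ℕ × Finset ℕ) :=
  [({1, 4, 5, 6}, {9}), ({1, 4, 6}, {8, 9}), ({1, 4, 8}, {7, 9}), ({1, 4}, {5, 7, 9}),
    ({3, 6, 7}, {1, 4}), ({6, 7}, {1, 2, 4}), ({1, 8, 9}, {6, 7}), ({8, 9}, {4, 6, 7}),
    ({1, 9}, {5, 6, 7}), ({9}, {4, 5, 6, 7})]

/-- The relabelling of the vertices carrying the result of `movesN5N6` to `N6`. -/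
def relabelN6 : Equiv.Perm ℕ :=
  [1, 5, 3, 7].formPerm * [2, 8, 4, 6].formPerm

end NPM

/-- `N_5` and `N_6` are bistellar equivalent: `N_6` can be
obtained from `N_5`, up to isomorphism, by a finite sequence of bistellar
moves (of any type `0 ≤ i ≤ 3`). -/
theorem statement10 :
    ∃ L : NPM.Complex ℕ, NPM.BEquiv 3 N5 L ∧ NPM.Iso L N6 := by
  refine ⟨_, NPM.AllFlippable.bEquiv (l := NPM.movesN5N6) ?_ ?_,
    NPM.relabelN6, NPM.relabelN6.injective.injOn, ?_⟩
  · decide +kernel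
  · decide +kernel
  · rw [NPM.genCx_image, N6]
    congr 1
    decide +kernel
end

section
/- Let K be a neighbourly combinatorial 3-manifold with exactly 8 vertices. Then K is isomorphic to S^3_{8,35}, S^3_{8,36}, S^3_{8,37} or S^3_{8,38}. -/
/-- The complex `S35` from the paper, generated by its facets. -/
def S35 : NPM.Complex ℕ :=
  NPM.genCx {{1,2,3,4}, {1,2,6,7}, {1,2,5,6}, {1,2,4,5}, {2,3,4,5}, {2,3,5,6}, {2,3,6,7}, {3,4,6,7}, {3,4,5,6}, {4,5,6,7}, {1,2,3,8}, {1,2,7,8}, {2,3,7,8}, {1,3,4,8}, {3,4,7,8}, {1,4,5,8}, {4,5,7,8}, {1,5,6,8}, {1,6,7,8}, {5,6,7,8}}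
/-- The complex `S36` from the paper, generated by its facets. -/
def S36 : NPM.Complex ℕ :=
  NPM.genCx {{1,2,3,4}, {1,2,5,6}, {1,2,4,5}, {1,5,6,7}, {2,3,4,5}, {2,3,5,6}, {2,3,6,7}, {3,4,6,7}, {3,4,5,6}, {4,5,6,7}, {1,2,6,8}, {1,6,7,8}, {2,6,7,8}, {1,2,3,8}, {2,3,7,8}, {1,3,4,8}, {3,4,7,8}, {1,4,5,8}, {1,5,7,8}, {4,5,7,8}}
/-- The complex `S37` from the paper, generated by its facets. -/
def S37 : NPM.Complex ℕ :=
  NPM.genCx {{1,2,3,4}, {1,2,5,6}, {1,2,4,5}, {1,4,5,7}, {2,3,4,5}, {2,3,5,6}, {2,3,6,7}, {3,4,6,7}, {3,4,5,6}, {4,5,6,7}, {1,5,6,8}, {1,5,7,8}, {5,6,7,8}, {1,2,6,8}, {2,6,7,8}, {1,2,3,8}, {2,3,7,8}, {1,3,4,8}, {1,4,7,8}, {3,4,7,8}}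
/-- The complex `S38` from the paper, generated by its facets. -/
def S38 : NPM.Complex ℕ :=
  NPM.genCx {{1,2,3,4}, {1,2,3,7}, {1,2,6,7}, {1,3,4,7}, {1,5,6,7}, {2,3,4,5}, {2,3,6,7}, {3,4,6,7}, {3,4,5,6}, {4,5,6,7}, {2,3,5,8}, {2,3,6,8}, {3,5,6,8}, {1,2,6,8}, {1,5,6,8}, {1,2,4,8}, {2,4,5,8}, {1,4,7,8}, {1,5,7,8}, {4,5,7,8}}

namespace NPM

section

theorem mem_facets {α : Type*} {K : Complex α} {d : ℕ} {σ : Finset α} :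
    σ ∈ facets K d ↔ σ ∈ K ∧ σ.card = d + 1 := Finset.mem_filter

variable {α : Type*} [DecidableEq α]

theorem mem_link {K : Complex α} {σ τ : Finset α} :
    τ ∈ link K σ ↔ τ ∈ K ∧ Disjoint τ σ ∧ σ ∪ τ ∈ K := Finset.mem_filter

theorem mem_verts {K : Complex α} {x : α} : x ∈ verts K ↔ ∃ σ ∈ K, x ∈ σ := by
  simp [verts, Finset.mem_sup]

theorem IsComplex.singleton_mem {K : Complex α} (h : IsComplex K) {x : α} :
    x ∈ verts K ↔ {x} ∈ K := by
  rw [mem_verts]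
  refine ⟨fun ⟨σ, hσ, hx⟩ => h.2.2 σ hσ _ (by simpa using hx) (by simp), fun hx => ⟨_, hx, by simp⟩⟩

theorem IsComplex.mem_link_singleton {K : Complex α} (h : IsComplex K) {x : α} {τ : Finset α} :
    τ ∈ link K {x} ↔ τ.Nonempty ∧ x ∉ τ ∧ insert x τ ∈ K := by
  rw [mem_link, Finset.disjoint_singleton_right, ← Finset.insert_eq]
  exact ⟨fun H => ⟨h.2.1 τ H.1, H.2⟩, fun H => ⟨h.2.2 _ H.2.2 _ (Finset.subset_insert x τ) H.1, H.2⟩⟩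

/-- The properties of the facets of a neighbourly combinatorial 3-manifold with eight vertices
on which the classification relies. -/
structure Triangulation (V : Finset α) (G : Finset (Finset α)) : Prop where
  card_eq : ∀ σ ∈ G, σ.card = 4
  subset : ∀ σ ∈ G, σ ⊆ V
  pair : ∀ x ∈ V, ∀ y ∈ V, ∃ σ ∈ G, x ∈ σ ∧ y ∈ σ
  card_eq_two : ∀ τ, τ.card = 3 → (∃ σ ∈ G, τ ⊆ σ) → (G.filter (τ ⊆ ·)).card = 2
  conn : ∀ x ∈ V, ∀ y ∈ V, ∀ P : Finset α → Prop, (∃ a ∈ G, x ∈ a ∧ y ∈ a ∧ P a) →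
    (∀ a ∈ G, ∀ b ∈ G, x ∈ a ∩ b → y ∈ a ∩ b → (a ∩ b).card = 3 → P a → P b) →
    ∀ b ∈ G, x ∈ b → y ∈ b → P b
  connected : ∀ P : Finset α → Prop, (∃ a ∈ G, P a) →
    (∀ a ∈ G, ∀ b ∈ G, (a ∩ b).card = 3 → P a → P b) → ∀ b ∈ G, P b
  count : ∀ x ∈ V, (G.filter (x ∈ ·)).card = 10

theorem SConn.induction {K : Complex α} {d : ℕ} (h : SConn K d) {P : Finset α → Prop}
    {a : Finset α} (ha : a ∈ facets K d) (hPa : P a)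
    (H : ∀ a ∈ facets K d, ∀ b ∈ facets K d, (a ∩ b).card = d → P a → P b) :
    ∀ b ∈ facets K d, P b := by
  intro b hb
  induction h a ha b hb with
  | refl => exact hPa
  | tail _ hbc ih => exact H _ hbc.1 _ hbc.2.1 hbc.2.2 (ih hbc.1)

variable {K : Complex α}

theorem Comb3Mfd.isComplex (h : Comb3Mfd K) : IsComplex K := h.1.1.1

theorem Comb3Mfd.conn_edge (h : Comb3Mfd K) {x y : α} (hxy : x ≠ y) {P : Finset α → Prop}
    {a : Finset α} (ha : a ∈ facets K 3) (hxa : x ∈ a) (hya : y ∈ a) (hPa : P a)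
    (H : ∀ a ∈ facets K 3, ∀ b ∈ facets K 3, x ∈ a ∩ b → y ∈ a ∩ b → (a ∩ b).card = 3 → P a → P b)
    {b : Finset α} (hb : b ∈ facets K 3) (hxb : x ∈ b) (hyb : y ∈ b) : P b := by
  have hK := h.isComplex
  have hx : {x} ∈ K := hK.2.2 a (mem_facets.1 ha).1 _ (by simpa using hxa) (by simp)
  have hL := (h.2 x hx).1
  have hy : {y} ∈ link K {x} := hK.mem_link_singleton.2 ⟨by simp, by simpa using hxy,
    hK.2.2 a (mem_facets.1 ha).1 _ (by simp [Finset.insert_subset_iff, hxa, hya]) (by simp)⟩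
  have hM := (hL.2 y hy).2
  have mem : ∀ c, c ∈ facets (link (link K {x}) {y}) 1 ↔
      c.card = 2 ∧ x ∉ c ∧ y ∉ c ∧ insert x (insert y c) ∈ K := by
    intro c
    rw [mem_facets, hL.1.1.mem_link_singleton, hK.mem_link_singleton]
    constructor
    · rintro ⟨⟨-, h1, -, h2, h3⟩, h4⟩
      exact ⟨h4, fun h => h2 (Finset.mem_insert_of_mem h), h1, h3⟩
    · rintro ⟨h1, h2, h3, h4⟩
      exact ⟨⟨Finset.card_pos.1 (by omega), h3, by simp, by simp [hxy, h2], h4⟩, h1⟩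
  have up : ∀ c ∈ facets (link (link K {x}) {y}) 1, insert x (insert y c) ∈ facets K 3 := by
    intro c hc
    obtain ⟨h1, h2, h3, h4⟩ := (mem c).1 hc
    refine mem_facets.2 ⟨h4, ?_⟩
    rw [Finset.card_insert_of_notMem (by simp [hxy, h2]), Finset.card_insert_of_notMem h3, h1]
  have down : ∀ b ∈ facets K 3, x ∈ b → y ∈ b →
      (b.erase x).erase y ∈ facets (link (link K {x}) {y}) 1 ∧
        insert x (insert y ((b.erase x).erase y)) = b := by
    intro b hb hxb hyb
    have hyb' : y ∈ b.erase x := Finset.mem_erase.2 ⟨hxy.symm, hyb⟩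
    have e : insert x (insert y ((b.erase x).erase y)) = b := by
      rw [Finset.insert_erase hyb', Finset.insert_erase hxb]
    refine ⟨(mem _).2 ⟨?_, by simp, by simp, by rw [e]; exact (mem_facets.1 hb).1⟩, e⟩
    rw [Finset.card_erase_of_mem hyb', Finset.card_erase_of_mem hxb, (mem_facets.1 hb).2]
  obtain ⟨ha', ea⟩ := down a ha hxa hya
  obtain ⟨hb', eb⟩ := down b hb hxb hyb
  rw [← eb]
  refine hM.induction (P := fun c => P (insert x (insert y c))) ha' (by rwa [ea]) ?_ _ hb'
  intro c hc d hd hcd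
  refine H _ (up c hc) _ (up d hd) (by simp) (by simp) ?_
  obtain ⟨-, h2, h3, -⟩ := (mem c).1 hc
  rw [← Finset.insert_inter_distrib, ← Finset.insert_inter_distrib,
    Finset.card_insert_of_notMem (by simp [hxy, h2]), Finset.card_insert_of_notMem (by simp [h3]),
    hcd]

theorem Comb3Mfd.exists_facet (h : Comb3Mfd K) {σ : Finset α} (hσ : σ ∈ K) :
    ∃ τ ∈ facets K 3, σ ⊆ τ := by
  obtain ⟨τ, h1, h2, h3⟩ := h.1.1.2.1 σ hσ
  exact ⟨τ, mem_facets.2 ⟨h1, h3⟩, h2⟩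

theorem Comb3Mfd.conn_vertex (h : Comb3Mfd K) {x : α} {P : Finset α → Prop}
    {a : Finset α} (ha : a ∈ facets K 3) (hxa : x ∈ a) (hPa : P a)
    (H : ∀ a ∈ facets K 3, ∀ b ∈ facets K 3, x ∈ a ∩ b → (a ∩ b).card = 3 → P a → P b)
    {b : Finset α} (hb : b ∈ facets K 3) (hxb : x ∈ b) : P b := by
  have hK := h.isComplex
  have hx : {x} ∈ K := hK.2.2 a (mem_facets.1 ha).1 _ (by simpa using hxa) (by simp)
  have key : ∀ a ∈ facets K 3, x ∈ a → ∃ u ∈ verts (link K {x}), u ∈ a ∧ x ≠ u := by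
    intro a ha hxa
    obtain ⟨u, hu⟩ : (a.erase x).Nonempty := Finset.card_pos.1 (by
      rw [Finset.card_erase_of_mem hxa, (mem_facets.1 ha).2]; omega)
    rw [Finset.mem_erase] at hu
    refine ⟨u, mem_verts.2 ⟨{u}, hK.mem_link_singleton.2 ⟨by simp, by simpa using hu.1.symm, ?_⟩,
      by simp⟩, hu.2, hu.1.symm⟩
    exact hK.2.2 a (mem_facets.1 ha).1 _ (by simp [Finset.insert_subset_iff, hxa, hu.2]) (by simp)
  have edge : ∀ u, x ≠ u → ∀ a ∈ facets K 3, x ∈ a → u ∈ a → P a →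
      ∀ b ∈ facets K 3, x ∈ b → u ∈ b → P b := fun u hu a ha hxa hua hPa b hb hxb hub =>
    h.conn_edge hu ha hxa hua hPa (fun a ha b hb h1 _ => H a ha b hb h1) hb hxb hub
  obtain ⟨u, hu, hua, hxu⟩ := key a ha hxa
  obtain ⟨v, hv, hvb, hxv⟩ := key b hb hxb
  suffices x ≠ v ∧ ∀ b ∈ facets K 3, x ∈ b → v ∈ b → P b from this.2 b hb hxb hvb
  clear hvb hxv
  induction (h.2 x hx).2.1.2 u hu v hv with
  | refl => exact ⟨hxu, edge u hxu a ha hxa hua hPa⟩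
  | @tail v w _ hvw ih =>
    obtain ⟨hvw, hmem⟩ := hvw
    rw [hK.mem_link_singleton] at hmem
    obtain ⟨c, hc, hsub⟩ := h.exists_facet hmem.2.2
    simp only [Finset.insert_subset_iff, Finset.singleton_subset_iff] at hsub
    have hv : v ∈ verts (link K {x}) := mem_verts.2 ⟨{v}, hK.mem_link_singleton.2
      ⟨by simp, fun h => hmem.2.1 (by simp_all), hK.2.2 c (mem_facets.1 hc).1 _
        (by simp [Finset.insert_subset_iff, hsub]) (by simp)⟩, by simp⟩
    have hxw : x ≠ w := fun h => hmem.2.1 (by simp [h])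
    exact ⟨hxw, edge w hxw c hc hsub.1 hsub.2.2 ((ih hv).2 c hc hsub.1 hsub.2.1)⟩

theorem WeakPM.two_mul_card {L : Complex α} (h : WeakPM L 2) :
    (L.filter fun σ => σ.card = 2).card * 2 = (L.filter fun σ => σ.card = 3).card * 3 := by
  refine Finset.card_mul_eq_card_mul (· ⊆ ·) (fun e he => ?_) fun t ht => ?_
  · rw [Finset.mem_filter] at he
    rw [← h.2.2 e he.1 he.2, Finset.bipartiteAbove, Finset.filter_filter]
    simp only [and_comm]
  · rw [Finset.mem_filter] at ht
    have : (L.filter fun σ => σ.card = 2).bipartiteBelow (· ⊆ ·) t = t.powersetCard 2 := by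
      ext e
      simp only [Finset.bipartiteBelow, Finset.mem_filter, Finset.mem_powersetCard]
      exact ⟨fun H => ⟨H.2, H.1.2⟩, fun H =>
        ⟨⟨h.1.2.2 t ht.1 e H.1 (Finset.card_pos.1 (by omega)), H.2⟩, H.1⟩⟩
    rw [this, Finset.card_powersetCard, ht.2]
    rfl

theorem Comb3Mfd.card_facets (h : Comb3Mfd K) (hN : Neighbourly K) (h8 : (verts K).card = 8)
    {x : α} (hx : x ∈ verts K) : ((facets K 3).filter (x ∈ ·)).card = 10 := by
  have hK := h.isComplex
  obtain ⟨⟨hL, -⟩, -, hχ⟩ := h.2 x (hK.singleton_mem.1 hx)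
  have h0 : ((link K {x}).filter fun σ => σ.card = 1).card = 7 := by
    have : (link K {x}).filter (fun σ => σ.card = 1) = ((verts K).erase x).map
        ⟨fun u => {u}, Finset.singleton_injective⟩ := by
      ext σ
      simp only [Finset.mem_filter, Finset.mem_map, Finset.mem_erase, Function.Embedding.coeFn_mk,
        hK.mem_link_singleton, Finset.card_eq_one]
      constructor
      · rintro ⟨⟨-, h1, h2⟩, u, rfl⟩
        exact ⟨u, ⟨fun e => h1 (by simp [e]), mem_verts.2 ⟨_, h2, by simp⟩⟩, rfl⟩
      · rintro ⟨u, ⟨h1, h2⟩, rfl⟩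
        exact ⟨⟨by simp, by simpa using h1.symm, hN x hx u h2 h1.symm⟩, u, rfl⟩
    rw [this, Finset.card_map, Finset.card_erase_of_mem hx, h8]
  have h2 : ((link K {x}).filter fun σ => σ.card = 3).card =
      ((facets K 3).filter (x ∈ ·)).card := by
    refine Finset.card_nbij' (insert x) (fun σ => σ.erase x) ?_ ?_ ?_ ?_
    · intro τ hτ
      simp only [Finset.coe_filter, Set.mem_ofPred_eq, hK.mem_link_singleton, mem_facets] at hτ ⊢
      exact ⟨⟨hτ.1.2.2, by rw [Finset.card_insert_of_notMem hτ.1.2.1, hτ.2]⟩, by simp⟩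
    · intro τ hτ
      simp only [Finset.coe_filter, Set.mem_ofPred_eq, hK.mem_link_singleton, mem_facets] at hτ ⊢
      have hc : (τ.erase x).card = 3 := by rw [Finset.card_erase_of_mem hτ.2, hτ.1.2]
      exact ⟨⟨Finset.card_pos.1 (by omega), by simp, by rw [Finset.insert_erase hτ.2]; exact hτ.1.1⟩,
        hc⟩
    · intro τ hτ
      simp only [Finset.coe_filter, Set.mem_ofPred_eq, hK.mem_link_singleton] at hτ
      exact Finset.erase_insert hτ.1.2.1
    · intro τ hτ
      simp only [Finset.coe_filter, Set.mem_ofPred_eq] at hτ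
      exact Finset.insert_erase hτ.2
  have h1 := hL.two_mul_card
  rw [eulerChar, h0] at hχ
  omega

theorem Comb3Mfd.triangulation (h : Comb3Mfd K) (hN : Neighbourly K) (h8 : (verts K).card = 8) :
    Triangulation (verts K) (facets K 3) where
  card_eq σ hσ := (mem_facets.1 hσ).2
  subset σ hσ x hx := mem_verts.2 ⟨σ, (mem_facets.1 hσ).1, hx⟩
  pair x hx y hy := by
    have : {x, y} ∈ K := by
      by_cases e : x = y
      · subst e
        simpa using h.isComplex.singleton_mem.1 hx
      · exact hN x hx y hy e
    obtain ⟨τ, h1, h2⟩ := h.exists_facet this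
    exact ⟨τ, h1, h2 (by simp), h2 (by simp)⟩
  card_eq_two τ hτ hσ := by
    obtain ⟨σ, hσ, hs⟩ := hσ
    rw [← h.1.1.2.2 τ (h.isComplex.2.2 σ (mem_facets.1 hσ).1 τ hs (Finset.card_pos.1 (by omega))) hτ,
      facets, Finset.filter_filter]
    simp only [and_comm]
  conn x hx y hy P := by
    rintro ⟨a, ha, hxa, hya, hPa⟩ H b hb hxb hyb
    by_cases e : x = y
    · subst e
      exact h.conn_vertex ha hxa hPa (fun a ha b hb h1 => H a ha b hb h1 h1) hb hxb
    · exact h.conn_edge e ha hxa hya hPa H hb hxb hyb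
  connected P := by
    rintro ⟨a, ha, hPa⟩ H
    exact h.1.2.induction ha hPa H
  count x hx := h.card_facets hN h8 hx

end

end NPM

/-! ### A search over bit masks

A set of vertices among `0, …, 7` is recorded as a mask `m < 256`, and a set of such masks as a
number `N < 2 ^ 256` whose binary digit at position `m` tells whether `m` belongs to the set. -/

namespace NPM.Search

/-- The set that consists of `i` alone. -/
def single (i : ℕ) : ℕ := Nat.shiftLeft 1 i

/-- Whether `i` belongs to the set `m`. -/
def has (m i : ℕ) : Bool := ((m.shiftRight i).land 1).beq 1

/-- The masks that contain the vertex `i`. -/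
def col (i : ℕ) : ℕ :=
  (((single 256).sub 1).div ((single (single i)).add 1)).shiftLeft (single i)

/-- The masks with three elements. -/
def triples : ℕ :=
  [7, 11, 13, 14, 19, 21, 22, 25, 26, 28, 35, 37, 38, 41, 42, 44, 49, 50, 52, 56, 67, 69, 70, 73,
    74, 76, 81, 82, 84, 88, 97, 98, 100, 104, 112, 131, 133, 134, 137, 138, 140, 145, 146, 148,
    152, 161, 162, 164, 168, 176, 193, 194, 196, 200, 208, 224].foldr (fun t N => (single t).lor N) 0

/-- The vertices `0, …, 7`. -/
def labels : List ℕ := [0, 1, 2, 3, 4, 5, 6, 7]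

/-- The elements of the mask `m`. -/
def elems (m : ℕ) : List ℕ := labels.filter fun i => has m i

/-- The masks obtained from `f` by deleting one of the vertices in `b`. -/
def boundary (f : ℕ) (b : List ℕ) : ℕ :=
  b.foldr (fun i N => (single (f.xor (single i))).lor N) (single f)

/-- The same value as `k x`, with `x` evaluated first. -/
def force {β : Type} (x : ℕ) (k : ℕ → β) : β := Nat.casesOn x (k 0) fun n => k n.succ

theorem force_eq {β : Type} (x : ℕ) (k : ℕ → β) : force x k = k x := by cases x <;> rfl

/-- If all known triangles through the edge `ij` are full, then the link of `ij` is complete.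
With `six`, links of edges that have six vertices are refuted. -/
def closeEdge (six : Bool) (once i j full : ℕ) (k : ℕ → Bool) : Bool :=
  force ((col i).land (col j)) fun M => force (once.land M) fun o =>
    (six && (o.land triples).beq (M.land triples)) ||
      bif (o.land full).beq o then force (full.lor M) k else k full

/-- If all known triangles through the vertex `i` are full, then the link of `i` is complete, has
ten triangles and contains all other vertices. -/
def closeVertex (l : List ℕ) (once i full : ℕ) (k : ℕ → Bool) : Bool :=
  force (col i) fun M => force (once.land M) fun o =>
    bif (o.land full).beq o then
      !((l.filter fun f => has f i).length.beq 10) ||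
      (labels.any fun j => (o.land (col j)).beq 0) ||
      force (full.lor M) k
    else k full

/-- Apply `closeEdge` to the edges between `i` and the vertices in the list. -/
def closeStar (six : Bool) (once i : ℕ) : List ℕ → ℕ → (ℕ → Bool) → Bool
  | [], full, k => k full
  | j :: b, full, k => closeEdge six once i j full fun full => closeStar six once i b full k

/-- Apply `closeEdge` and `closeVertex` to all edges and vertices in the list. -/
def closeAll (six : Bool) (l : List ℕ) (once : ℕ) : List ℕ → ℕ → (ℕ → Bool) → Bool
  | [], full, k => k full
  | i :: b, full, k => closeStar six once i b full fun full =>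
      closeVertex l once i full fun full => closeAll six l once b full k

/-- Add the facet `f` with vertices `b` to a partial triangulation, that is, to a list `l` of
facets, given with the set of triangles that lie in at least one of them and a set of triangles
known to lie in no further facet. The result is `true` if this is contradictory. -/
def add (six : Bool) (f : ℕ) (b l : List ℕ) (once full : ℕ) (k : List ℕ → ℕ → ℕ → Bool) : Bool :=
  force (boundary f b) fun T =>
    !((T.land full).beq 0) ||
    force ((full.lor (once.land T)).lor (single f)) fun full => force (once.lor T) fun once =>
      closeAll six (f :: l) once b full fun full => k (f :: l) once full

/-- The position of the leading binary digit of `x`, found by bisection, plus `t`. -/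
def leading : List ℕ → ℕ → ℕ → ℕ
  | [], _, t => t
  | w :: l, x, t => force (x.shiftRight w) fun y =>
    bif y.beq 0 then leading l x t else leading l y (t.add w)

/-- Add several facets. -/
def addAll (six : Bool) (k : List ℕ → ℕ → ℕ → Bool) : List ℕ → List ℕ → ℕ → ℕ → Bool
  | [], l, once, full => k l once full
  | f :: m, l, once, full => add six f (elems f) l once full (addAll six k m)

/-- All complete triangulations that extend the given one and are not refuted satisfy `leaf`. -/
def search (six : Bool) (leaf : List ℕ → Bool) : ℕ → List ℕ → ℕ → ℕ → Bool
  | 0, _, _, _ => false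
  | n + 1, l, once, full => force (once.xor (once.land full)) fun o =>
    bif o.beq 0 then leaf l
    else force (leading [128, 64, 32, 16, 8, 4, 2, 1] o 0) fun t => has o t && labels.all fun v =>
      has t v || force (t.xor (single v)) fun f =>
        add six f (v :: elems t) l once full (search six leaf n)

theorem has_eq (m i : ℕ) : has m i = m.testBit i := by
  rw [Bool.eq_iff_iff, Nat.testBit_eq_decide_div_mod_eq, decide_eq_true_eq,
    ← Nat.shiftRight_eq_div_pow, ← Nat.and_one_is_mod]
  exact iff_of_eq Nat.beq_eq

theorem single_eq (i : ℕ) : single i = 2 ^ i := Nat.one_shiftLeft i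

theorem testBit_single (i t : ℕ) : (single i).testBit t = decide (i = t) := by
  rw [single_eq, Nat.testBit_two_pow]

theorem testBit_land (m n i : ℕ) : (m.land n).testBit i = (m.testBit i && n.testBit i) :=
  Nat.testBit_and m n i

theorem testBit_lor (m n i : ℕ) : (m.lor n).testBit i = (m.testBit i || n.testBit i) :=
  Nat.testBit_or m n i

theorem testBit_xor (m n i : ℕ) : (m.xor n).testBit i = (m.testBit i ^^ n.testBit i) :=
  Nat.testBit_xor m n i

theorem testBit_xor_single (m i j : ℕ) :
    (m.xor (single i)).testBit j = (m.testBit j ^^ decide (i = j)) := by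
  rw [testBit_xor, testBit_single]

theorem mem_labels {i : ℕ} : i ∈ labels ↔ i < 8 := by
  simp only [labels, List.mem_cons, List.not_mem_nil, or_false]
  omega

theorem mem_elems {m i : ℕ} : i ∈ elems m ↔ i < 8 ∧ m.testBit i = true := by
  simp [elems, mem_labels, has_eq]

theorem nodup_elems (m : ℕ) : (elems m).Nodup := List.Nodup.filter _ (by decide)

theorem testBit_col {i t : ℕ} (hi : i < 8) (ht : t < 256) : (col i).testBit t = t.testBit i := by
  have h : ∀ i < 8, ∀ t < 256, has (col i) t = has t i := by decide +kernel
  simpa only [has_eq] using h i hi t ht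

theorem lt_of_testBit_col {i t : ℕ} (hi : i < 8) (h : (col i).testBit t = true) : t < 256 := by
  have h' : ∀ i < 8, col i < 2 ^ 256 := by decide +kernel
  by_contra! h''
  rw [Nat.testBit_lt_two_pow ((h' i hi).trans_le (Nat.pow_le_pow_right (by norm_num) h''))] at h
  simp at h

/-- The mask `t` arises from `f` by deleting a vertex. -/
def Face (t f : ℕ) : Prop := ∃ i < 8, f.testBit i = true ∧ t = f.xor (single i)

theorem Face.testBit {t f i : ℕ} (h : Face t f) (ht : t.testBit i = true) : f.testBit i = true := by
  obtain ⟨j, -, hj, rfl⟩ := h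
  rw [testBit_xor_single] at ht
  by_cases hij : j = i
  · exact hij ▸ hj
  · simpa [hij] using ht

theorem testBit_boundary {f : ℕ} {b : List ℕ} (hb : ∀ i, i ∈ b ↔ i < 8 ∧ f.testBit i = true)
    (t : ℕ) : (boundary f b).testBit t = true ↔ t = f ∨ Face t f := by
  have h : ∀ b : List ℕ, (boundary f b).testBit t = true ↔
      t = f ∨ ∃ i ∈ b, t = f.xor (single i) := by
    intro b
    induction b with
    | nil => simp [boundary, testBit_single, eq_comm]
    | cons i b ih =>
      have : boundary f (i :: b) = (single (f.xor (single i))).lor (boundary f b) := rfl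
      rw [this, testBit_lor, Bool.or_eq_true, ih, testBit_single, decide_eq_true_eq]
      simp only [List.mem_cons, exists_eq_or_imp, eq_comm (a := t)]
      tauto
  rw [h]
  simp only [hb, Face, and_assoc]

/-- The properties of the set `F` of facets of a neighbourly triangulation on which the search
relies. -/
structure Model (F : ℕ → Prop) (six : Bool) : Prop where
  lt : ∀ f, F f → f < 256
  pair : ∀ i < 8, ∀ j < 8, ∃ f, F f ∧ f.testBit i = true ∧ f.testBit j = true
  not_face : ∀ a b, F a → F b → ¬ Face a b
  other : ∀ t a, F a → Face t a →
    ∃ v < 8, t.testBit v = false ∧ F (t.xor (single v)) ∧ t.xor (single v) ≠ a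
  two : ∀ t a b c, F a → F b → F c → Face t a → Face t b → Face t c → a ≠ b → c = a ∨ c = b
  conn : ∀ i < 8, ∀ j < 8, ∀ P : ℕ → Prop,
    (∃ a, F a ∧ P a ∧ a.testBit i = true ∧ a.testBit j = true) →
    (∀ t a b, F a → F b → P a → Face t a → Face t b →
      t.testBit i = true → t.testBit j = true → P b) →
    ∀ b, F b → b.testBit i = true → b.testBit j = true → P b
  connected : ∀ P : ℕ → Prop, (∃ a, F a ∧ P a) →
    (∀ t a b, F a → F b → P a → Face t a → Face t b → P b) → ∀ b, F b → P b
  count : ∀ i < 8, ∀ l : List ℕ, l.Nodup → (∀ f, f ∈ l ↔ F f ∧ f.testBit i = true) → l.length = 10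
  six : six = true → ∀ i < 8, ∀ j < 8, i ≠ j → ∃ w < 8, w ≠ i ∧ w ≠ j ∧
    ∀ f, F f → f.testBit i = true → f.testBit j = true → f.testBit w = false

/-- The invariant of the search. -/
structure Inv (F : ℕ → Prop) (l : List ℕ) (once full : ℕ) : Prop where
  nodup : l.Nodup
  facet : ∀ f ∈ l, F f
  full_self : ∀ f ∈ l, full.testBit f = true
  once_iff : ∀ t, once.testBit t = true ↔ ∃ f ∈ l, t = f ∨ Face t f
  mem_of_full : ∀ t, full.testBit t = true → ∀ g, F g → t = g ∨ Face t g → g ∈ l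
  full_of_two : ∀ t, ∀ a ∈ l, ∀ b ∈ l, a ≠ b → Face t a → Face t b → full.testBit t = true

variable {F : ℕ → Prop} {six : Bool} {l : List ℕ} {once full : ℕ}

theorem Inv.nil (F : ℕ → Prop) : Inv F [] 0 0 := by
  constructor <;> simp

theorem Inv.lor (h : Inv F l once full) {M : ℕ}
    (hM : ∀ t, M.testBit t = true → ∀ g, F g → t = g ∨ Face t g → g ∈ l) :
    Inv F l once (full.lor M) where
  nodup := h.nodup
  facet := h.facet
  full_self f hf := by rw [testBit_lor, h.full_self f hf, Bool.true_or]
  once_iff := h.once_iff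
  mem_of_full t ht := by
    rw [testBit_lor, Bool.or_eq_true] at ht
    exact ht.elim (h.mem_of_full t) (hM t)
  full_of_two t a ha b hb hab hta htb := by
    rw [testBit_lor, h.full_of_two t a ha b hb hab hta htb, Bool.true_or]

/-- If all known triangles through `i` and `j` are full, then all facets that contain `i` and `j`
are known. -/
theorem Inv.mem_of_closed (hF : Model F six) (h : Inv F l once full) {M i j : ℕ} (hi : i < 8)
    (hj : j < 8) (hl : ∃ a ∈ l, a.testBit i = true ∧ a.testBit j = true)
    (hM : ∀ t < 256, t.testBit i = true → t.testBit j = true → M.testBit t = true)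
    (hc : ((once.land M).land full).beq (once.land M) = true) (b : ℕ) (hb : F b)
    (hbi : b.testBit i = true) (hbj : b.testBit j = true) : b ∈ l := by
  refine hF.conn i hi j hj (· ∈ l) ?_ ?_ b hb hbi hbj
  · obtain ⟨a, ha, h'⟩ := hl
    exact ⟨a, h.facet a ha, ha, h'⟩
  · intro t a b hFa hFb ha hta htb hti htj
    refine h.mem_of_full t ?_ b hFb (Or.inr htb)
    have ht : t < 256 := by
      obtain ⟨v, hv, hav, rfl⟩ := hta
      exact Nat.xor_lt_two_pow (n := 8) (hF.lt a hFa)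
        (single_eq v ▸ Nat.pow_lt_pow_right (by norm_num) hv)
    have ho : (once.land M).testBit t = true := by
      rw [testBit_land, (h.once_iff t).2 ⟨a, ha, Or.inr hta⟩, hM t ht hti htj, Bool.and_true]
    rw [← Nat.eq_of_beq_eq_true hc, testBit_land, Bool.and_eq_true] at ho
    exact ho.2

theorem testBit_of_near {t g i : ℕ} (h : t = g ∨ Face t g) (ht : t.testBit i = true) :
    g.testBit i = true :=
  h.elim (fun h => h ▸ ht) fun h => h.testBit ht

theorem closeEdge_sound (hF : Model F six) (h : Inv F l once full) {i j : ℕ} (hi : i < 8)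
    (hj : j < 8) (hij : i ≠ j) (hl : ∃ a ∈ l, a.testBit i = true ∧ a.testBit j = true)
    {k : ℕ → Bool} (hk : closeEdge six once i j full k = true) :
    ∃ full, Inv F l once full ∧ k full = true := by
  simp only [closeEdge, force_eq, Bool.or_eq_true, Bool.and_eq_true] at hk
  rcases hk with ⟨hs, ho⟩ | hk
  · exfalso
    obtain ⟨w, hw, hwi, hwj, H⟩ := hF.six hs i hi j hj hij
    have key : ∀ i j w : Fin 8, i ≠ j → w ≠ i → w ≠ j →
        has (((col i).land (col j)).land triples) (((single i).lor (single j)).lor (single w))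
          = true := by decide +kernel
    have ht := key ⟨i, hi⟩ ⟨j, hj⟩ ⟨w, hw⟩ (by simpa using hij) (by simpa using hwi)
      (by simpa using hwj)
    dsimp only at ht
    set t := ((single i).lor (single j)).lor (single w) with htd
    have hti : t.testBit i = true := by
      rw [htd, testBit_lor, testBit_lor, testBit_single, decide_eq_true rfl, Bool.true_or,
        Bool.true_or]
    have htj : t.testBit j = true := by
      rw [htd, testBit_lor, testBit_lor, testBit_single j, decide_eq_true rfl, Bool.or_true,
        Bool.true_or]
    have htw : t.testBit w = true := by
      rw [htd, testBit_lor, testBit_single w, decide_eq_true rfl, Bool.or_true]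
    rw [has_eq] at ht
    rw [← Nat.eq_of_beq_eq_true ho, testBit_land, testBit_land, Bool.and_eq_true,
      Bool.and_eq_true] at ht
    obtain ⟨f, hf, hn⟩ := (h.once_iff t).1 ht.1.1
    have := H f (h.facet f hf) (testBit_of_near hn hti) (testBit_of_near hn htj)
    rw [testBit_of_near hn htw] at this
    exact absurd this (by simp)
  · cases hc : ((once.land ((col i).land (col j))).land full).beq
        (once.land ((col i).land (col j))) with
    | false => exact ⟨full, h, by simpa only [hc, cond_false] using hk⟩
    | true =>
      refine ⟨_, h.lor fun t ht g hg hn => ?_, by simpa only [hc, cond_true] using hk⟩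
      rw [testBit_land, Bool.and_eq_true] at ht
      have h256 := lt_of_testBit_col hi ht.1
      rw [testBit_col hi h256, testBit_col hj h256] at ht
      refine h.mem_of_closed hF hi hj hl ?_ hc g hg (testBit_of_near hn ht.1)
        (testBit_of_near hn ht.2)
      intro t h256 hti htj
      rw [testBit_land, testBit_col hi h256, testBit_col hj h256, hti, htj, Bool.and_true]

theorem closeVertex_sound (hF : Model F six) (h : Inv F l once full) {i : ℕ} (hi : i < 8)
    (hl : ∃ a ∈ l, a.testBit i = true) {k : ℕ → Bool}
    (hk : closeVertex l once i full k = true) : ∃ full, Inv F l once full ∧ k full = true := by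
  simp only [closeVertex, force_eq] at hk
  cases hc : ((once.land (col i)).land full).beq (once.land (col i)) with
  | false => exact ⟨full, h, by simpa only [hc, cond_false] using hk⟩
  | true =>
    have hcol : ∀ t < 256, t.testBit i = true → (col i).testBit t = true :=
      fun t ht hti => by rw [testBit_col hi ht, hti]
    have hmem := fun b hb hbi => h.mem_of_closed hF hi hi (by simpa only [and_self] using hl)
      (fun t ht hti _ => hcol t ht hti) hc b hb hbi hbi
    simp only [hc, cond_true, Bool.or_eq_true, Bool.not_eq_true', List.any_eq_true] at hk
    rcases hk with (hk | ⟨j, hj, hk⟩) | hk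
    · have := hF.count i hi (l.filter fun f => has f i) (h.nodup.filter _) fun f => by
        rw [List.mem_filter, has_eq]
        exact ⟨fun hf => ⟨h.facet f hf.1, hf.2⟩, fun hf => ⟨hmem f hf.1 hf.2, hf.2⟩⟩
      rw [this] at hk
      exact absurd hk (by decide)
    · rw [mem_labels] at hj
      obtain ⟨f, hf, hfi, hfj⟩ := hF.pair i hi j hj
      have : ((once.land (col i)).land (col j)).testBit f = true := by
        rw [testBit_land, testBit_land, (h.once_iff f).2 ⟨f, hmem f hf hfi, Or.inl rfl⟩,
          hcol f (hF.lt f hf) hfi, testBit_col hj (hF.lt f hf), hfj, Bool.and_true, Bool.and_true]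
      rw [Nat.eq_of_beq_eq_true hk, Nat.zero_testBit] at this
      exact absurd this (by simp)
    · refine ⟨_, h.lor fun t ht g hg hn => hmem g hg (testBit_of_near hn ?_), hk⟩
      rwa [testBit_col hi (lt_of_testBit_col hi ht)] at ht

theorem closeStar_sound (hF : Model F six) {i : ℕ} (hi : i < 8) {k : ℕ → Bool} (b : List ℕ)
    (hb : ∀ j ∈ b, j < 8 ∧ i ≠ j ∧ ∃ a ∈ l, a.testBit i = true ∧ a.testBit j = true) :
    ∀ {full : ℕ}, Inv F l once full → closeStar six once i b full k = true →
      ∃ full, Inv F l once full ∧ k full = true := by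
  induction b with
  | nil => exact fun h hk => ⟨_, h, hk⟩
  | cons j b ih =>
    intro full h hk
    obtain ⟨hj, hij, hl⟩ := hb j (by simp)
    obtain ⟨full', h', hk'⟩ := closeEdge_sound hF h hi hj hij hl hk
    exact ih (fun j hj => hb j (by simp [hj])) h' hk'

theorem closeAll_sound (hF : Model F six) {f : ℕ} (hf : f ∈ l) {k : ℕ → Bool} (b : List ℕ)
    (hb : ∀ j ∈ b, j < 8 ∧ f.testBit j = true) (hn : b.Nodup) :
    ∀ {full : ℕ}, Inv F l once full → closeAll six l once b full k = true →
      ∃ full, Inv F l once full ∧ k full = true := by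
  induction b with
  | nil => exact fun h hk => ⟨_, h, hk⟩
  | cons i b ih =>
    intro full h hk
    rw [List.nodup_cons] at hn
    have hi := hb i (by simp)
    have hb' : ∀ j ∈ b, j < 8 ∧ f.testBit j = true := fun j hj => hb j (by simp [hj])
    obtain ⟨full', h', hk'⟩ := closeStar_sound hF hi.1 b
      (fun j hj => ⟨(hb' j hj).1, fun hij => hn.1 (hij ▸ hj), f, hf, hi.2, (hb' j hj).2⟩) h hk
    obtain ⟨full'', h'', hk''⟩ := closeVertex_sound hF h' hi.1 ⟨f, hf, hi.2⟩ hk'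
    exact ih hb' hn.2 h'' hk''

theorem add_sound (hF : Model F six) (h : Inv F l once full) {f : ℕ} (hf : F f) (hfl : f ∉ l)
    {b : List ℕ} (hb : ∀ i, i ∈ b ↔ i < 8 ∧ f.testBit i = true) (hn : b.Nodup)
    {k : List ℕ → ℕ → ℕ → Bool} (hk : add six f b l once full k = true) :
    ∃ once full, Inv F (f :: l) once full ∧ k (f :: l) once full = true := by
  simp only [add, force_eq, Bool.or_eq_true, Bool.not_eq_true'] at hk
  rcases hk with hk | hk
  · exfalso
    refine absurd hk ?_
    rw [Bool.not_eq_false, Nat.beq_eq]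
    refine Nat.eq_of_testBit_eq fun t => ?_
    rw [Nat.zero_testBit, testBit_land, Bool.and_eq_false_iff, or_iff_not_imp_left,
      Bool.not_eq_false, testBit_boundary hb]
    intro ht
    rw [← Bool.not_eq_true]
    exact fun h' => hfl (h.mem_of_full t h' f hf ht)
  · refine ⟨_, closeAll_sound hF (List.mem_cons_self) b (fun j hj => (hb j).1 hj) hn ?_ hk⟩
    have hnear : ∀ t a, a ∈ l → Face t a → Face t f →
        (((full.lor (once.land (boundary f b))).lor (single f))).testBit t = true := by
      intro t a ha hta htf
      rw [testBit_lor, testBit_lor, testBit_land, (testBit_boundary hb t).2 (Or.inr htf),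
        (h.once_iff t).2 ⟨a, ha, Or.inr hta⟩, Bool.and_true, Bool.or_true, Bool.true_or]
    constructor
    · exact List.nodup_cons.2 ⟨hfl, h.nodup⟩
    · simpa [hf] using h.facet
    · intro g hg
      rcases List.mem_cons.1 hg with rfl | hg
      · rw [testBit_lor, testBit_single, decide_eq_true rfl, Bool.or_true]
      · rw [testBit_lor, testBit_lor, h.full_self g hg, Bool.true_or, Bool.true_or]
    · intro t
      rw [testBit_lor, Bool.or_eq_true, h.once_iff, testBit_boundary hb]
      simp only [List.mem_cons, exists_eq_or_imp]
      exact or_comm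
    · intro t ht g hg htg
      rw [List.mem_cons]
      simp only [testBit_lor, testBit_land, testBit_single, Bool.or_eq_true, Bool.and_eq_true,
        decide_eq_true_eq, testBit_boundary hb, h.once_iff] at ht
      rcases ht with (ht | ⟨⟨a, ha, hta⟩, htf⟩) | rfl
      · exact Or.inr (h.mem_of_full t ht g hg htg)
      · rcases hta with rfl | hta
        · exact Or.inr (h.mem_of_full t (h.full_self t ha) g hg htg)
        · rcases htf with rfl | htf
          · exact absurd hta (hF.not_face _ _ hf (h.facet a ha))
          · rcases htg with rfl | htg
            · exact absurd htf (hF.not_face _ _ hg hf)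
            · refine (hF.two t f a g hf (h.facet a ha) hg htf hta htg fun e => ?_).imp id ?_
              · exact hfl (e ▸ ha)
              · exact fun e => e ▸ ha
      · rcases htg with e | htg
        · exact Or.inl e.symm
        · exact absurd htg (hF.not_face _ _ hf hg)
    · intro t a ha c hc hac hta htc
      rcases List.mem_cons.1 ha with ea | ha <;> rcases List.mem_cons.1 hc with ec | hc
      · exact absurd (ea.trans ec.symm) hac
      · exact hnear t c hc htc (ea ▸ hta)
      · exact hnear t a ha hta (ec ▸ htc)
      · rw [testBit_lor, testBit_lor, h.full_of_two t a ha c hc hac hta htc, Bool.true_or,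
          Bool.true_or]

theorem addAll_sound (hF : Model F six) {k : List ℕ → ℕ → ℕ → Bool} (m : List ℕ)
    (hm : ∀ f ∈ m, F f) (hn : m.Nodup) : ∀ {l : List ℕ} {once full : ℕ}, (∀ f ∈ m, f ∉ l) →
      Inv F l once full → addAll six k m l once full = true →
        ∃ l once full, Inv F l once full ∧ k l once full = true ∧ ∀ f ∈ m, f ∈ l := by
  suffices H : ∀ {l : List ℕ} {once full : ℕ}, (∀ f ∈ m, f ∉ l) →
      Inv F l once full → addAll six k m l once full = true →
        ∃ l' once full, Inv F l' once full ∧ k l' once full = true ∧ (∀ f ∈ m, f ∈ l') ∧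
          ∀ f ∈ l, f ∈ l' by
    intro l once full hml h hk
    obtain ⟨l', once', full', h1, h2, h3, -⟩ := H hml h hk
    exact ⟨l', once', full', h1, h2, h3⟩
  induction m with
  | nil => exact fun _ h hk => ⟨_, _, _, h, hk, by simp, fun f hf => hf⟩
  | cons f m ih =>
    intro l once full hml h hk
    rw [List.nodup_cons] at hn
    obtain ⟨once', full', h', hk'⟩ := add_sound hF h (hm f (by simp)) (hml f (by simp))
      (fun i => mem_elems) (nodup_elems f) hk
    obtain ⟨l', once'', full'', h1, h2, h3, h4⟩ := ih (fun g hg => hm g (by simp [hg])) hn.2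
      (fun g hg => by
        rw [List.mem_cons, not_or]
        exact ⟨fun e => hn.1 (e ▸ hg), hml g (by simp [hg])⟩) h' hk'
    refine ⟨l', once'', full'', h1, h2, ?_, fun g hg => h4 g (by simp [hg])⟩
    intro g hg
    rcases List.mem_cons.1 hg with rfl | hg
    · exact h4 _ (by simp)
    · exact h3 g hg

theorem Face.lt {t f : ℕ} (h : Face t f) (hf : f < 256) : t < 256 := by
  obtain ⟨v, hv, -, rfl⟩ := h
  exact Nat.xor_lt_two_pow (n := 8) hf (single_eq v ▸ Nat.pow_lt_pow_right (by norm_num) hv)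

theorem face_xor_single {t v : ℕ} (hv : v < 8) (h : t.testBit v = false) :
    Face t (t.xor (single v)) := by
  refine ⟨v, hv, by rw [testBit_xor_single, h]; simp, ?_⟩
  exact (Nat.xor_xor_cancel_right t (single v)).symm

theorem search_sound (hF : Model F six) {leaf : List ℕ → Bool} (n : ℕ) :
    ∀ {l : List ℕ} {once full : ℕ}, l ≠ [] → Inv F l once full →
      search six leaf n l once full = true → ∃ l, leaf l = true ∧ ∀ f, F f ↔ f ∈ l := by
  induction n with
  | zero => exact fun _ _ hk => absurd hk (by simp [search])
  | succ n ih =>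
    intro l once full hl h hk
    simp only [search, force_eq] at hk
    cases ho : (once.xor (once.land full)).beq 0 with
    | true =>
      simp only [ho, cond_true] at hk
      refine ⟨l, hk, fun f => ⟨fun hf => ?_, h.facet f⟩⟩
      refine hF.connected (· ∈ l) ?_ ?_ f hf
      · obtain ⟨a, ha⟩ := List.exists_mem_of_ne_nil l hl
        exact ⟨a, h.facet a ha, ha⟩
      · intro t a b hFa hFb ha hta htb
        refine h.mem_of_full t ?_ b hFb (Or.inr htb)
        have : (once.xor (once.land full)).testBit t = false := by
          rw [Nat.eq_of_beq_eq_true ho, Nat.zero_testBit]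
        rw [testBit_xor, testBit_land, (h.once_iff t).2 ⟨a, ha, Or.inr hta⟩] at this
        simpa using this
    | false =>
      simp only [ho, cond_false] at hk
      generalize leading [128, 64, 32, 16, 8, 4, 2, 1] (once.xor (once.land full)) 0 = t at hk
      rw [Bool.and_eq_true, List.all_eq_true, has_eq, testBit_xor, testBit_land] at hk
      obtain ⟨ht, hk⟩ := hk
      have ht' : once.testBit t = true ∧ full.testBit t = false := by
        revert ht; cases once.testBit t <;> cases full.testBit t <;> simp
      obtain ⟨a, ha, hta⟩ := (h.once_iff t).1 ht'.1
      rcases hta with rfl | hta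
      · exact absurd (h.full_self t ha) (by simp [ht'.2])
      obtain ⟨v, hv, hvt, hf, hfa⟩ := hF.other t a (h.facet a ha) hta
      have htf := face_xor_single hv hvt
      have hfl : t.xor (single v) ∉ l := fun hfl =>
        absurd (h.full_of_two t _ hfl a ha hfa htf hta) (by simp [ht'.2])
      have := hk v (mem_labels.2 hv)
      rw [has_eq, hvt, Bool.false_or] at this
      have hb : ∀ i, i ∈ v :: elems t ↔ i < 8 ∧ (t.xor (single v)).testBit i = true := by
        intro i
        rw [List.mem_cons, mem_elems, testBit_xor_single]
        by_cases e : v = i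
        · subst e; simp [hv, hvt]
        · simp [e, Ne.symm e]
      have hn : (v :: elems t).Nodup :=
        List.nodup_cons.2 ⟨fun e => by simp [(mem_elems.1 e).2] at hvt, nodup_elems t⟩
      obtain ⟨once', full', h', hk'⟩ := add_sound hF h hf hfl hb hn this
      exact ih (List.cons_ne_nil _ _) h' hk'

theorem exists_list_of_addAll (hF : Model F six) {leaf : List ℕ → Bool} {n : ℕ} {m : List ℕ}
    (hm : ∀ f ∈ m, F f) (hn : m.Nodup) (h0 : m ≠ [])
    (h : addAll six (search six leaf n) m [] 0 0 = true) :
    ∃ l, leaf l = true ∧ ∀ f, F f ↔ f ∈ l := by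
  obtain ⟨l, once, full, hl, hk, hml⟩ := addAll_sound hF m hm hn (by simp) (Inv.nil F) h
  refine search_sound hF n ?_ hl hk
  obtain ⟨f, hf⟩ := List.exists_mem_of_ne_nil m h0
  exact List.ne_nil_of_mem (hml f hf)

/-! ### From complexes to masks -/

section

variable {α : Type*}

/-- `e` labels the elements of `V` by `0, …, 7`. -/
structure Labelling (V : Finset α) (e : ℕ → α) : Prop where
  inj : ∀ i < 8, ∀ j < 8, e i = e j → i = j
  mem_iff : ∀ x, x ∈ V ↔ ∃ i < 8, e i = x

variable {V : Finset α} {e : ℕ → α}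

theorem Labelling.mem (he : Labelling V e) {i : ℕ} (hi : i < 8) : e i ∈ V :=
  (he.mem_iff _).2 ⟨i, hi, rfl⟩

theorem Labelling.ext (he : Labelling V e) {σ τ : Finset α} (hσ : σ ⊆ V) (hτ : τ ⊆ V)
    (h : ∀ i < 8, e i ∈ σ ↔ e i ∈ τ) : σ = τ := by
  ext x
  constructor <;> intro hx
  · obtain ⟨i, hi, rfl⟩ := (he.mem_iff x).1 (hσ hx)
    exact (h i hi).1 hx
  · obtain ⟨i, hi, rfl⟩ := (he.mem_iff x).1 (hτ hx)
    exact (h i hi).2 hx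

variable [DecidableEq α]

/-- The set of vertices described by the mask `m`. -/
def unmask (e : ℕ → α) (m : ℕ) : Finset α := ((Finset.range 8).filter (m.testBit ·)).image e

theorem mem_unmask {m : ℕ} {x : α} :
    x ∈ unmask e m ↔ ∃ i < 8, m.testBit i = true ∧ e i = x := by
  simp [unmask, and_assoc]

theorem Labelling.apply_mem_unmask (he : Labelling V e) {m i : ℕ} (hi : i < 8) :
    e i ∈ unmask e m ↔ m.testBit i = true := by
  rw [mem_unmask]
  refine ⟨fun ⟨j, hj, h, h'⟩ => ?_, fun h => ⟨i, hi, h, rfl⟩⟩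
  rwa [← he.inj j hj i hi h']

theorem Labelling.unmask_subset (he : Labelling V e) (m : ℕ) : unmask e m ⊆ V := fun x hx => by
  obtain ⟨i, hi, -, rfl⟩ := mem_unmask.1 hx
  exact he.mem hi

theorem Labelling.unmask_inj (he : Labelling V e) {m n : ℕ} (hm : m < 256) (hn : n < 256)
    (h : unmask e m = unmask e n) : m = n := by
  refine Nat.eq_of_testBit_eq fun i => ?_
  by_cases hi : i < 8
  · rw [Bool.eq_iff_iff, ← he.apply_mem_unmask hi, ← he.apply_mem_unmask hi, h]
  · have : 256 ≤ 2 ^ i := Nat.pow_le_pow_right (n := 2) (by norm_num) (not_lt.1 hi)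
    rw [Nat.testBit_lt_two_pow (hm.trans_le this), Nat.testBit_lt_two_pow (hn.trans_le this)]

theorem Labelling.exists_unmask (he : Labelling V e) {σ : Finset α} (hσ : σ ⊆ V) :
    ∃ m < 256, unmask e m = σ := by
  refine ⟨Nat.ofBits fun i : Fin 8 => decide (e i ∈ σ), Nat.ofBits_lt_two_pow _,
    he.ext (he.unmask_subset _) hσ fun i hi => ?_⟩
  rw [he.apply_mem_unmask hi, Nat.testBit_ofBits_lt _ _ hi, decide_eq_true_eq]

theorem xor_single_lt {m v : ℕ} (hm : m < 256) (hv : v < 8) : m.xor (single v) < 256 :=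
  Nat.xor_lt_two_pow (n := 8) hm (single_eq v ▸ Nat.pow_lt_pow_right (by norm_num) hv)

theorem Labelling.unmask_xor_of_testBit (he : Labelling V e) {m v : ℕ} (hv : v < 8)
    (h : m.testBit v = true) : unmask e (m.xor (single v)) = (unmask e m).erase (e v) := by
  refine he.ext (he.unmask_subset _)
    ((Finset.erase_subset _ _).trans (he.unmask_subset _)) fun i hi => ?_
  rw [he.apply_mem_unmask hi, Finset.mem_erase, he.apply_mem_unmask hi, testBit_xor_single]
  by_cases hvi : v = i
  · subst hvi; simp [h]
  · have hne : e i ≠ e v := fun h => hvi (he.inj i hi v hv h).symm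
    simp [hvi, hne]

theorem Labelling.card_of_face (he : Labelling V e) {t f : ℕ} (h : Face t f) :
    unmask e t ⊆ unmask e f ∧ (unmask e f).card = (unmask e t).card + 1 := by
  obtain ⟨v, hv, hvf, rfl⟩ := h
  rw [he.unmask_xor_of_testBit hv hvf]
  exact ⟨Finset.erase_subset _ _,
    (Finset.card_erase_add_one ((he.apply_mem_unmask hv).2 hvf)).symm⟩

theorem Labelling.face_of_subset (he : Labelling V e) {t f : ℕ} (ht : t < 256) (hf : f < 256)
    (h : unmask e t ⊆ unmask e f) (hc : (unmask e f).card = (unmask e t).card + 1) :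
    Face t f := by
  obtain ⟨x, hx, hxf⟩ := Finset.exists_eq_insert_iff.2 ⟨h, hc.symm⟩
  have hx' : x ∈ unmask e f := hxf ▸ Finset.mem_insert_self _ _
  obtain ⟨v, hv, hvf, rfl⟩ := mem_unmask.1 hx'
  refine ⟨v, hv, hvf, he.unmask_inj ht (xor_single_lt hf hv) ?_⟩
  rw [he.unmask_xor_of_testBit hv hvf, ← hxf, Finset.erase_insert hx]

variable {G : Finset (Finset α)}

theorem _root_.NPM.Triangulation.exists_ne (T : Triangulation V G) {τ σ : Finset α}
    (hτ : τ.card = 3) (hσ : σ ∈ G) (h : τ ⊆ σ) : ∃ ρ ∈ G, τ ⊆ ρ ∧ ρ ≠ σ := by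
  obtain ⟨ρ, hρ, hne⟩ := Finset.exists_mem_ne
    (s := G.filter (τ ⊆ ·)) (by rw [T.card_eq_two τ hτ ⟨σ, hσ, h⟩]; omega) σ
  rw [Finset.mem_filter] at hρ
  exact ⟨ρ, hρ.1, hρ.2, hne⟩

theorem _root_.NPM.Triangulation.eq_or_eq (T : Triangulation V G) {τ a b c : Finset α}
    (hτ : τ.card = 3) (ha : a ∈ G) (hb : b ∈ G) (hc : c ∈ G) (hta : τ ⊆ a) (htb : τ ⊆ b)
    (htc : τ ⊆ c) (hab : a ≠ b) : c = a ∨ c = b := by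
  by_contra! h
  have : ({a, b, c} : Finset (Finset α)) ⊆ G.filter (τ ⊆ ·) := by
    simp [Finset.insert_subset_iff, ha, hb, hc, hta, htb, htc]
  have := Finset.card_le_card this
  rw [T.card_eq_two τ hτ ⟨a, ha, hta⟩,
    Finset.card_eq_three.2 ⟨a, b, c, hab, h.1.symm, h.2.symm, rfl⟩] at this
  omega

theorem Labelling.model (he : Labelling V e) (T : Triangulation V G) {six : Bool}
    (h6 : six = true → ∀ x ∈ V, ∀ y ∈ V, x ≠ y →
      ∃ w ∈ V, w ≠ x ∧ w ≠ y ∧ ∀ σ ∈ G, x ∈ σ → y ∈ σ → w ∉ σ) :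
    Model (fun m => m < 256 ∧ unmask e m ∈ G) six := by
  have hface : ∀ {t a : ℕ}, unmask e a ∈ G → Face t a →
      unmask e t ⊆ unmask e a ∧ (unmask e t).card = 3 := by
    intro t a ha hta
    have := he.card_of_face hta
    rw [T.card_eq _ ha] at this
    exact ⟨this.1, by omega⟩
  have hadj : ∀ {a b : ℕ}, a < 256 → unmask e a ∈ G → b < 256 → unmask e b ∈ G →
      (unmask e a ∩ unmask e b).card = 3 →
      ∃ t, unmask e t = unmask e a ∩ unmask e b ∧ Face t a ∧ Face t b := by
    intro a b ha ha' hb hb' hab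
    obtain ⟨t, ht, e'⟩ := he.exists_unmask
      (Finset.inter_subset_left.trans (he.unmask_subset a) : unmask e a ∩ unmask e b ⊆ V)
    refine ⟨t, e', he.face_of_subset ht ha ?_ ?_, he.face_of_subset ht hb ?_ ?_⟩
    · rw [e']; exact Finset.inter_subset_left
    · rw [e', hab, T.card_eq _ ha']
    · rw [e']; exact Finset.inter_subset_right
    · rw [e', hab, T.card_eq _ hb']
  constructor
  · exact fun f hf => hf.1
  · intro i hi j hj
    obtain ⟨σ, hσ, h1, h2⟩ := T.pair _ (he.mem hi) _ (he.mem hj)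
    obtain ⟨m, hm, rfl⟩ := he.exists_unmask (T.subset σ hσ)
    exact ⟨m, ⟨hm, hσ⟩, (he.apply_mem_unmask hi).1 h1, (he.apply_mem_unmask hj).1 h2⟩
  · intro a b ha hb hab
    have := (he.card_of_face hab).2
    rw [T.card_eq _ ha.2, T.card_eq _ hb.2] at this
    omega
  · intro t a ha hta
    obtain ⟨hs, hc⟩ := hface ha.2 hta
    obtain ⟨ρ, hρ, hsub, hne⟩ := T.exists_ne hc ha.2 hs
    obtain ⟨b, hb, rfl⟩ := he.exists_unmask (T.subset ρ hρ)
    obtain ⟨v, hv, hvb, htb⟩ := he.face_of_subset (hta.lt ha.1) hb hsub (by rw [hc, T.card_eq _ hρ])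
    have hbt : t.xor (single v) = b := by
      rw [htb]; exact Nat.xor_xor_cancel_right b (single v)
    refine ⟨v, hv, by rw [htb, testBit_xor_single, hvb]; simp, ?_, ?_⟩
    · rw [hbt]; exact ⟨hb, hρ⟩
    · rw [hbt]; rintro rfl; exact hne rfl
  · intro t a b c ha hb hc hta htb htc hab
    obtain ⟨h1, h2⟩ := hface ha.2 hta
    exact (T.eq_or_eq h2 ha.2 hb.2 hc.2 h1 (hface hb.2 htb).1 (hface hc.2 htc).1
      fun h => hab (he.unmask_inj ha.1 hb.1 h)).imp (he.unmask_inj hc.1 ha.1)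
        (he.unmask_inj hc.1 hb.1)
  · rintro i hi j hj P ⟨a, ha, hPa, hia, hja⟩ H b hb hib hjb
    refine T.conn _ (he.mem hi) _ (he.mem hj) (fun σ => ∀ m < 256, unmask e m = σ → P m)
      ⟨_, ha.2, (he.apply_mem_unmask hi).2 hia, (he.apply_mem_unmask hj).2 hja,
        fun m hm hma => he.unmask_inj hm ha.1 hma ▸ hPa⟩ ?_ _ hb.2
      ((he.apply_mem_unmask hi).2 hib) ((he.apply_mem_unmask hj).2 hjb) b hb.1 rfl
    rintro σ hσ τ hτ hi' hj' hc hP b hb rfl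
    obtain ⟨a, ha, rfl⟩ := he.exists_unmask (T.subset σ hσ)
    obtain ⟨t, ht, hta, htb⟩ := hadj ha hσ hb hτ hc
    rw [← ht, he.apply_mem_unmask hi] at hi'
    rw [← ht, he.apply_mem_unmask hj] at hj'
    exact H t a b ⟨ha, hσ⟩ ⟨hb, hτ⟩ (hP a ha rfl) hta htb hi' hj'
  · rintro P ⟨a, ha, hPa⟩ H b hb
    refine T.connected (fun σ => ∀ m < 256, unmask e m = σ → P m)
      ⟨_, ha.2, fun m hm hma => he.unmask_inj hm ha.1 hma ▸ hPa⟩ ?_ _ hb.2 b hb.1 rfl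
    rintro σ hσ τ hτ hc hP b hb rfl
    obtain ⟨a, ha, rfl⟩ := he.exists_unmask (T.subset σ hσ)
    obtain ⟨t, ht, hta, htb⟩ := hadj ha hσ hb hτ hc
    exact H t a b ⟨ha, hσ⟩ ⟨hb, hτ⟩ (hP a ha rfl) hta htb
  · intro i hi l hl hmem
    rw [← T.count (e i) (he.mem hi), ← List.toFinset_card_of_nodup hl]
    refine Finset.card_bij (fun m _ => unmask e m) ?_ ?_ ?_
    · intro m hm
      rw [List.mem_toFinset, hmem] at hm
      exact Finset.mem_filter.2 ⟨hm.1.2, (he.apply_mem_unmask hi).2 hm.2⟩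
    · intro m hm n hn
      rw [List.mem_toFinset, hmem] at hm hn
      exact he.unmask_inj hm.1.1 hn.1.1
    · intro σ hσ
      rw [Finset.mem_filter] at hσ
      obtain ⟨m, hm, rfl⟩ := he.exists_unmask (T.subset σ hσ.1)
      exact ⟨m, List.mem_toFinset.2 ((hmem m).2 ⟨⟨hm, hσ.1⟩, (he.apply_mem_unmask hi).1 hσ.2⟩), rfl⟩
  · intro hs i hi j hj hij
    obtain ⟨w, hw, h1, h2, h3⟩ := h6 hs _ (he.mem hi) _ (he.mem hj) fun h => hij (he.inj i hi j hj h)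
    obtain ⟨k, hk, rfl⟩ := (he.mem_iff w).1 hw
    refine ⟨k, hk, fun h => h1 (h ▸ rfl), fun h => h2 (h ▸ rfl), fun f hf hfi hfj => ?_⟩
    rw [← Bool.not_eq_true, ← he.apply_mem_unmask hk]
    exact h3 _ hf.2 ((he.apply_mem_unmask hi).2 hfi) ((he.apply_mem_unmask hj).2 hfj)

end

/-! ### Links of edges -/

section

variable {α : Type*}

/-- The properties of the adjacency relation of a cycle. -/
structure CycleRel (R : α → α → Prop) : Prop where
  symm : ∀ a b, R a b → R b a
  irrefl : ∀ a, ¬ R a a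
  other : ∀ a b, R a b → ∃ c, R a c ∧ c ≠ b
  two : ∀ a b c d, R a b → R a c → R a d → b ≠ c → d = b ∨ d = c
  conn : ∀ P : α → Prop, (∃ a b, R a b ∧ P a) → (∀ a b, R a b → P a → P b) → ∀ a b, R a b → P a

theorem CycleRel.exists_cycle [DecidableEq α] {R : α → α → Prop} (h : CycleRel R)
    {W T : Finset α} (hW : W.card = 6) (hTW : T ⊆ W) (hT : ∀ a, a ∈ T ↔ ∃ b, R a b)
    (h5 : 5 ≤ T.card) :
    (∃ c₀ c₁ c₂ c₃ c₄ c₅, [c₀, c₁, c₂, c₃, c₄, c₅].Nodup ∧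
      R c₀ c₁ ∧ R c₁ c₂ ∧ R c₂ c₃ ∧ R c₃ c₄ ∧ R c₄ c₅ ∧ R c₅ c₀) ∨
    ∃ c₀ c₁ c₂ c₃ c₄, [c₀, c₁, c₂, c₃, c₄].Nodup ∧
      R c₀ c₁ ∧ R c₁ c₂ ∧ R c₂ c₃ ∧ R c₃ c₄ ∧ R c₄ c₀ ∧ T.card = 5 := by
  have cover : ∀ c d : α, ∀ S : Finset α, R c d → c ∈ S → (∀ a ∈ S, ∀ b, R a b → b ∈ S) →
      T.card ≤ S.card := by
    intro c d S hcd hc hS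
    refine Finset.card_le_card fun a ha => ?_
    obtain ⟨b, hab⟩ := (hT a).1 ha
    exact h.conn (· ∈ S) ⟨c, d, hcd, hc⟩ (fun a b hab ha => hS a ha b hab) a b hab
  have ne : ∀ a b, R a b → a ≠ b := fun a b hab e => h.irrefl b (e ▸ hab)
  have two := h.two
  have symm := h.symm
  obtain ⟨c₁, hc₁⟩ : T.Nonempty := Finset.card_pos.1 (by omega)
  obtain ⟨c₀, h₁₀⟩ := (hT c₁).1 hc₁
  obtain ⟨c₂, h₁₂, n₂₀⟩ := h.other _ _ h₁₀
  obtain ⟨c₃, h₂₃, n₃₁⟩ := h.other _ _ (h.symm _ _ h₁₂)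
  obtain ⟨c₄, h₃₄, n₄₂⟩ := h.other _ _ (h.symm _ _ h₂₃)
  have h₀₁ := h.symm _ _ h₁₀
  have h₂₁ := h.symm _ _ h₁₂
  have h₃₂ := h.symm _ _ h₂₃
  have h₄₃ := h.symm _ _ h₃₄
  have n₀₁ := ne _ _ h₀₁
  have n₁₂ := ne _ _ h₁₂
  have n₂₃ := ne _ _ h₂₃
  have n₃₄ := ne _ _ h₃₄
  have n₃₀ : c₃ ≠ c₀ := by
    rintro rfl
    have := cover c₁ c₂ {c₃, c₁, c₂} h₁₂ (by simp) (by
      intro a ha b hab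
      simp only [Finset.mem_insert, Finset.mem_singleton] at ha ⊢
      grind)
    have := this.trans Finset.card_le_three
    omega
  have n₄₁ : c₄ ≠ c₁ := by grind
  have n₄₀ : c₄ ≠ c₀ := by
    rintro rfl
    have := cover c₁ c₂ {c₄, c₁, c₂, c₃} h₁₂ (by simp) (by
      intro a ha b hab
      simp only [Finset.mem_insert, Finset.mem_singleton] at ha ⊢
      grind)
    have := this.trans Finset.card_le_four
    omega
  obtain ⟨c₅, h₄₅, n₅₃⟩ := h.other _ _ h₄₃
  have h₅₄ := h.symm _ _ h₄₅
  have n₄₅ := ne _ _ h₄₅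
  have n₅₁ : c₅ ≠ c₁ := by grind
  have n₅₂ : c₅ ≠ c₂ := by grind
  by_cases n₅₀ : c₅ = c₀
  · subst n₅₀
    refine Or.inr ⟨c₅, c₁, c₂, c₃, c₄, by simp; grind, h₀₁, h₁₂, h₂₃, h₃₄, h₄₅, ?_⟩
    have := cover c₁ c₂ {c₅, c₁, c₂, c₃, c₄} h₁₂ (by simp) (by
      intro a ha b hab
      simp only [Finset.mem_insert, Finset.mem_singleton] at ha ⊢
      grind)
    have := this.trans Finset.card_le_five
    omega
  · left
    obtain ⟨c₆, h₅₆, n₆₄⟩ := h.other _ _ h₅₄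
    have n₆₅ := (ne _ _ h₅₆).symm
    have n₆₁ : c₆ ≠ c₁ := by grind
    have n₆₂ : c₆ ≠ c₂ := by grind
    have n₆₃ : c₆ ≠ c₃ := by grind
    have hn : [c₀, c₁, c₂, c₃, c₄, c₅].Nodup := by simp; grind
    have hmem : c₆ ∈ [c₀, c₁, c₂, c₃, c₄, c₅].toFinset := by
      have : [c₀, c₁, c₂, c₃, c₄, c₅].toFinset = W := by
        refine Finset.eq_of_subset_of_card_le ?_ ?_
        · intro a ha
          refine hTW ((hT a).2 ?_)
          simp only [List.mem_toFinset, List.mem_cons, List.not_mem_nil, or_false] at ha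
          rcases ha with rfl | rfl | rfl | rfl | rfl | rfl
          exacts [⟨_, h₀₁⟩, ⟨_, h₁₂⟩, ⟨_, h₂₃⟩, ⟨_, h₃₄⟩, ⟨_, h₄₅⟩, ⟨_, h₅₄⟩]
        · rw [List.toFinset_card_of_nodup hn, hW]
          rfl
      rw [this]
      exact hTW ((hT _).2 ⟨_, h.symm _ _ h₅₆⟩)
    have n₆₀ : c₆ = c₀ := by simpa [n₆₁, n₆₂, n₆₃, n₆₄, n₆₅] using hmem
    exact ⟨c₀, c₁, c₂, c₃, c₄, c₅, hn, h₀₁, h₁₂, h₂₃, h₃₄, h₄₅, n₆₀ ▸ h₅₆⟩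

variable [DecidableEq α] {V : Finset α} {G : Finset (Finset α)}

theorem exists_eq_of_mem {σ : Finset α} (hσ : σ.card = 4) {x y a : α} (hx : x ∈ σ) (hy : y ∈ σ)
    (ha : a ∈ σ) (h : ({x, y, a} : Finset α).card = 3) : ∃ b, σ = {x, y, a, b} := by
  obtain ⟨b, -, hb⟩ := Finset.exists_eq_insert_iff.2
    ⟨(by simp [Finset.insert_subset_iff, hx, hy, ha] : ({x, y, a} : Finset α) ⊆ σ), by omega⟩
  refine ⟨b, hb.symm.trans ?_⟩
  ext; simp; tauto

theorem card_three {x y a : α} (hxy : x ≠ y) (hxa : a ≠ x) (hya : a ≠ y) :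
    ({x, y, a} : Finset α).card = 3 :=
  Finset.card_eq_three.2 ⟨x, y, a, hxy, hxa.symm, hya.symm, rfl⟩

theorem ne_of_card_four {x y a b : α} (h : ({x, y, a, b} : Finset α).card = 4) :
    a ≠ x ∧ a ≠ y ∧ b ≠ x ∧ b ≠ y ∧ a ≠ b := by
  have key : ∀ p q r : α, ({x, y, a, b} : Finset α) ≠ {p, q, r} := fun p q r e => by
    have := Finset.card_le_three (a := p) (b := q) (c := r)
    rw [← e] at this
    omega
  refine ⟨?_, ?_, ?_, ?_, ?_⟩ <;> rintro rfl
  · exact key a y b (by ext; simp; tauto)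
  · exact key x a b (by ext; simp)
  · exact key b y a (by ext; simp; tauto)
  · exact key x b a (by ext; simp; tauto)
  · exact key x y a (by ext; simp)

theorem _root_.NPM.Triangulation.cycleRel (T : Triangulation V G) {x y : α} (hx : x ∈ V)
    (hy : y ∈ V) (hxy : x ≠ y) : CycleRel fun a b => {x, y, a, b} ∈ G := by
  have ne : ∀ {a b : α}, {x, y, a, b} ∈ G → a ≠ x ∧ a ≠ y ∧ b ≠ x ∧ b ≠ y ∧ a ≠ b :=
    fun h => ne_of_card_four (T.card_eq _ h)
  have c3 : ∀ {a b : α}, {x, y, a, b} ∈ G → ({x, y, a} : Finset α).card = 3 :=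
    fun h => card_three hxy (ne h).1 (ne h).2.1
  have sub : ∀ a b : α, ({x, y, a} : Finset α) ⊆ {x, y, a, b} := fun a b z => by simp; tauto
  have cancel : ∀ {a b c : α}, {x, y, a, b} ∈ G →
      ({x, y, a, b} : Finset α) = {x, y, a, c} → b = c := by
    intro a b c hb e
    have : b ∈ ({x, y, a, c} : Finset α) := by rw [← e]; simp
    simp only [Finset.mem_insert, Finset.mem_singleton] at this
    have := ne hb
    tauto
  constructor
  · intro a b h
    rwa [Finset.pair_comm]
  · exact fun a h => (ne h).2.2.2.2 rfl
  · intro a b h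
    obtain ⟨ρ, hρ, hs, hne⟩ := T.exists_ne (c3 h) h (sub a b)
    obtain ⟨c, rfl⟩ := exists_eq_of_mem (T.card_eq ρ hρ) (hs (by simp)) (hs (by simp))
      (hs (by simp)) (c3 h)
    exact ⟨c, hρ, fun e => hne (e ▸ rfl)⟩
  · intro a b c d hb hc hd hbc
    exact (T.eq_or_eq (c3 hb) hb hc hd (sub a b) (sub a c) (sub a d)
      fun e => hbc (cancel hb e)).imp (cancel hd) (cancel hd)
  · rintro P ⟨a, b, hab, ha⟩ H c d hcd
    refine T.conn x hx y hy (fun σ => ∀ z ∈ σ, z ≠ x → z ≠ y → P z)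
      ⟨_, hab, by simp, by simp, ?_⟩ ?_ _ hcd (by simp) (by simp) c (by simp) (ne hcd).1 (ne hcd).2.1
    · intro z hz hzx hzy
      simp only [Finset.mem_insert, Finset.mem_singleton, hzx, hzy, false_or] at hz
      rcases hz with rfl | rfl
      · exact ha
      · exact H _ _ hab ha
    · intro σ hσ τ hτ hxi hyi hc hP z hz hzx hzy
      obtain ⟨u, hu, hu'⟩ := Finset.exists_mem_notMem_of_card_lt_card
        (s := {x, y}) (t := σ ∩ τ) (by rw [hc, Finset.card_pair hxy]; omega)
      simp only [Finset.mem_insert, Finset.mem_singleton, not_or] at hu'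
      rw [Finset.mem_inter] at hu hxi hyi
      obtain ⟨v, rfl⟩ := exists_eq_of_mem (T.card_eq τ hτ) hxi.2 hyi.2 hu.2
        (card_three hxy hu'.1 hu'.2)
      have hPu := hP u hu.1 hu'.1 hu'.2
      simp only [Finset.mem_insert, Finset.mem_singleton, hzx, hzy, false_or] at hz
      rcases hz with rfl | rfl
      · exact hPu
      · exact H _ _ hτ hPu

/-- The vertices of the link of the edge `xy`. -/
def touched (G : Finset (Finset α)) (x y : α) : Finset α :=
  ((G.filter fun σ => x ∈ σ ∧ y ∈ σ).sup id \ {x, y})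

theorem mem_touched {x y a : α} :
    a ∈ touched G x y ↔ (∃ σ ∈ G, x ∈ σ ∧ y ∈ σ ∧ a ∈ σ) ∧ a ≠ x ∧ a ≠ y := by
  simp [touched, Finset.mem_sup, and_assoc]

theorem _root_.NPM.Triangulation.mem_touched_iff (T : Triangulation V G) {x y a : α}
    (hxy : x ≠ y) : a ∈ touched G x y ↔ ∃ b, {x, y, a, b} ∈ G := by
  rw [mem_touched]
  constructor
  · rintro ⟨⟨σ, hσ, hx, hy, ha⟩, hax, hay⟩
    obtain ⟨b, rfl⟩ := exists_eq_of_mem (T.card_eq σ hσ) hx hy ha (card_three hxy hax hay)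
    exact ⟨b, hσ⟩
  · rintro ⟨b, hb⟩
    have := ne_of_card_four (T.card_eq _ hb)
    exact ⟨⟨_, hb, by simp, by simp, by simp⟩, this.1, this.2.1⟩

theorem _root_.NPM.Triangulation.touched_subset (T : Triangulation V G) (x y : α) :
    touched G x y ⊆ (V.erase x).erase y := fun a ha => by
  obtain ⟨⟨σ, hσ, -, -, ha⟩, hx, hy⟩ := mem_touched.1 ha
  exact Finset.mem_erase.2 ⟨hy, Finset.mem_erase.2 ⟨hx, T.subset σ hσ ha⟩⟩

theorem _root_.NPM.Triangulation.card_touched (T : Triangulation V G) {x y : α} (hxy : x ≠ y) :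
    (touched G x y).card = (G.filter fun σ => x ∈ σ ∧ y ∈ σ).card := by
  suffices (touched G x y).card * 2 = (G.filter fun σ => x ∈ σ ∧ y ∈ σ).card * 2 by omega
  refine Finset.card_mul_eq_card_mul (· ∈ ·) (fun a ha => ?_) fun σ hσ => ?_
  · obtain ⟨⟨σ, hσ, hx, hy, ha⟩, hax, hay⟩ := mem_touched.1 ha
    rw [← T.card_eq_two {x, y, a} (card_three hxy hax hay)
      ⟨σ, hσ, by simp [Finset.insert_subset_iff, hx, hy, ha]⟩, Finset.bipartiteAbove,
      Finset.filter_filter]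
    simp only [Finset.insert_subset_iff, Finset.singleton_subset_iff, and_assoc]
  · rw [Finset.mem_filter] at hσ
    have : (touched G x y).bipartiteBelow (· ∈ ·) σ = (σ.erase x).erase y := by
      ext a
      simp only [Finset.bipartiteBelow, Finset.mem_filter, mem_touched, Finset.mem_erase]
      exact ⟨fun h => ⟨h.1.2.2, h.1.2.1, h.2⟩, fun h =>
        ⟨⟨⟨σ, hσ.1, hσ.2.1, hσ.2.2, h.2.2⟩, h.2.1, h.1⟩, h.2.2⟩⟩
    rw [this, Finset.card_erase_of_mem (Finset.mem_erase.2 ⟨hxy.symm, hσ.2.2⟩),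
      Finset.card_erase_of_mem hσ.2.1, T.card_eq σ hσ.1]

theorem _root_.NPM.Triangulation.exists_five_le (T : Triangulation V G) (h8 : V.card = 8) :
    ∃ x ∈ V, ∃ y ∈ V, x ≠ y ∧ 5 ≤ (touched G x y).card := by
  obtain ⟨x, hx⟩ : V.Nonempty := Finset.card_pos.1 (by omega)
  by_contra! H
  have h1 : ∑ y ∈ V.erase x, ((G.filter (x ∈ ·)).filter (y ∈ ·)).card =
      ∑ σ ∈ G.filter (x ∈ ·), ((V.erase x).filter (· ∈ σ)).card :=
    Finset.sum_card_bipartiteAbove_eq_sum_card_bipartiteBelow (fun y σ => y ∈ σ)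
  have h2 : ∑ σ ∈ G.filter (x ∈ ·), ((V.erase x).filter (· ∈ σ)).card = 30 := by
    rw [Finset.sum_congr rfl (g := fun _ => 3), Finset.sum_const, T.count x hx]
    · rfl
    · intro σ hσ
      rw [Finset.mem_filter] at hσ
      have : (V.erase x).filter (· ∈ σ) = σ.erase x := by
        ext a
        simp only [Finset.mem_filter, Finset.mem_erase]
        exact ⟨fun h => ⟨h.1.1, h.2⟩, fun h => ⟨⟨h.1, T.subset σ hσ.1 h.2⟩, h.2⟩⟩
      rw [this, Finset.card_erase_of_mem hσ.2, T.card_eq σ hσ.1]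
  have h3 : ∑ y ∈ V.erase x, ((G.filter (x ∈ ·)).filter (y ∈ ·)).card ≤
      (V.erase x).card • 4 := by
    refine Finset.sum_le_card_nsmul _ _ _ fun y hy => ?_
    rw [Finset.mem_erase] at hy
    rw [Finset.filter_filter, ← T.card_touched hy.1.symm]
    have := H x hx y hy.2 hy.1.symm
    omega
  rw [h1, h2, Finset.card_erase_of_mem hx, h8] at h3
  norm_num at h3

end

/-- The relabellings that are needed to recognize `S35`. -/
def perms35 : List (List ℕ) := [
  [1,4,5,6,7,8,3,2], [1,2,3,4,5,6,7,8], [1,2,3,4,7,8,5,6], [1,2,3,4,5,8,7,6], [1,4,5,6,7,8,2,3],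
  [1,2,5,6,7,8,4,3], [1,2,5,6,7,8,3,4], [1,2,3,6,7,8,5,4], [1,2,3,4,7,8,6,5], [1,2,3,6,7,8,4,5],
  [1,2,3,4,5,6,8,7], [1,2,3,4,5,8,6,7]]

/-- The relabellings that are needed to recognize `S36`. -/
def perms36 : List (List ℕ) := [
  [1,6,2,3,4,5,7,8], [3,6,7,8,1,2,5,4], [3,2,1,8,7,6,5,4], [1,5,4,3,2,6,7,8], [1,2,3,6,7,8,4,5],
  [1,8,7,6,5,4,3,2], [3,2,8,1,5,4,7,6], [1,5,4,3,2,8,7,6], [1,8,7,6,3,2,5,4], [3,4,5,1,6,2,8,7],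
  [3,4,5,1,8,2,6,7], [1,8,7,6,5,2,3,4], [1,6,2,3,4,5,8,7], [1,2,5,6,7,8,4,3], [1,4,5,6,7,8,2,3],
  [1,8,2,3,4,5,6,7], [3,6,7,8,1,2,4,5], [3,2,6,7,5,4,8,1], [1,2,3,6,7,8,5,4], [3,2,8,1,5,4,6,7],
  [1,2,5,6,7,8,3,4], [3,2,6,1,5,4,8,7], [3,2,1,8,7,6,4,5], [3,4,5,7,6,2,8,1], [1,8,7,6,3,2,4,5],
  [1,4,5,6,7,8,3,2], [3,4,5,1,6,2,7,8], [3,2,6,7,5,4,1,8], [3,2,6,1,5,4,7,8], [3,4,5,7,6,2,1,8],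
  [3,4,5,1,8,2,7,6], [1,8,2,3,4,5,7,6], [1,5,4,3,2,6,8,7], [1,8,7,6,5,4,2,3], [1,5,4,3,2,8,6,7],
  [1,8,7,6,5,2,4,3]]

/-- The relabellings that are needed to recognize `S37`. -/
def perms37 : List (List ℕ) := [
  [1,4,3,2,6,5,7,8], [1,5,6,2,3,4,7,8], [2,5,6,7,8,1,4,3], [2,1,8,7,6,5,4,3], [1,2,3,4,7,8,6,5],
  [6,5,1,4,3,2,8,7], [2,3,4,7,8,1,5,6], [1,8,7,6,5,4,3,2], [3,4,1,5,6,2,8,7], [3,2,1,8,7,4,5,6],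
  [2,1,8,7,4,3,6,5], [5,6,2,3,4,1,8,7], [5,2,1,8,7,6,3,4], [1,2,5,6,7,8,3,4], [2,6,5,7,4,3,8,1],
  [2,3,4,7,5,6,8,1], [1,8,7,6,5,2,3,4], [5,6,2,3,4,7,8,1], [6,2,3,4,1,5,7,8], [6,2,3,4,7,5,1,8],
  [3,2,6,5,7,4,1,8], [3,2,6,5,1,4,7,8], [5,2,1,8,7,6,4,3], [1,2,5,6,7,8,4,3], [1,4,5,6,7,8,2,3],
  [5,1,4,3,2,6,7,8], [1,4,3,2,6,5,8,7], [1,2,3,4,7,8,5,6], [2,6,5,1,4,3,8,7], [3,4,7,8,1,2,6,5],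
  [6,5,1,4,3,2,7,8], [3,4,1,5,6,2,7,8], [3,4,7,5,6,2,1,8], [6,5,2,1,8,7,4,3], [1,5,6,2,3,4,8,7],
  [3,2,1,8,7,4,6,5], [1,8,7,4,3,2,5,6], [2,3,4,1,5,6,8,7], [2,1,8,7,4,3,5,6], [6,2,3,4,1,5,8,7],
  [1,4,5,6,7,8,3,2], [1,8,7,4,3,2,6,5], [2,6,5,7,4,3,1,8], [2,3,4,7,5,6,1,8], [2,6,5,1,4,3,7,8],
  [2,3,4,1,5,6,7,8], [2,5,6,7,8,1,3,4], [2,1,8,7,6,5,3,4], [6,2,3,4,7,5,8,1], [3,2,6,5,7,4,8,1],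
  [3,4,7,5,6,2,8,1], [6,5,2,1,8,7,3,4], [2,3,4,7,8,1,6,5], [3,2,6,5,1,4,8,7], [5,1,4,3,2,6,8,7],
  [3,4,7,8,1,2,5,6], [1,8,7,6,5,4,2,3], [5,6,2,3,4,1,7,8], [1,8,7,6,5,2,4,3], [5,6,2,3,4,7,1,8]]

/-- The relabellings that are needed to recognize `S38`. -/
def perms38 : List (List ℕ) := [
  [1,4,5,8,6,7,3,2], [4,3,2,6,5,8,1,7], [3,4,8,5,6,2,1,7], [4,1,7,6,8,5,3,2], [1,4,5,8,6,7,2,3],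
  [3,2,4,7,1,6,5,8], [3,4,8,5,6,2,7,1], [1,7,4,2,3,6,8,5], [4,1,7,6,8,5,2,3], [1,7,4,2,3,6,5,8],
  [4,3,2,6,5,8,7,1], [3,2,4,7,1,6,8,5]]

/-- The masks of the facets of `S35`, with labels `1, …, 8`. -/
def masks35 : List ℕ :=
  [30, 54, 60, 102, 108, 120, 198, 204, 216, 240, 270, 282,
    306, 354, 390, 396, 408, 432, 450, 480]

/-- The masks of the facets of `S36`, with labels `1, …, 8`. -/
def masks36 : List ℕ :=
  [30, 54, 60, 102, 108, 120, 204, 216, 226, 240, 270, 282,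
    306, 326, 396, 408, 418, 432, 450, 452]

/-- The masks of the facets of `S37`, with labels `1, …, 8`. -/
def masks37 : List ℕ :=
  [30, 54, 60, 102, 108, 120, 178, 204, 216, 240, 270, 282,
    326, 354, 396, 402, 408, 418, 452, 480]

/-- The masks of the facets of `S38`, with labels `1, …, 8`. -/
def masks38 : List ℕ :=
  [30, 60, 120, 142, 154, 198, 204, 216, 226, 240, 278, 300,
    308, 326, 332, 354, 360, 402, 418, 432]

/-- The mask of the image of `f` under the map `i ↦ p[i]`. -/
def relabel (f : ℕ) : ℕ → List ℕ → ℕ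
  | _, [] => 0
  | i, x :: p => bif has f i then (single x).lor (relabel f (i + 1) p) else relabel f (i + 1) p

/-- The relabelling `p` maps the facets in `l` onto those in `m`. -/
def isIso (p l m : List ℕ) : Bool :=
  force (m.foldr (fun f N => (single f).lor N) 0) fun N => (l.all fun f => has N (relabel f 0 p)) &&
    m.all fun g => l.any fun f => g.beq (relabel f 0 p)

/-- The complex with facets `l` is isomorphic to one in the list of known complexes. -/
def known (l : List ℕ) : Bool :=
  (perms35.any fun p => isIso p l masks35) || (perms36.any fun p => isIso p l masks36) ||
  (perms37.any fun p => isIso p l masks37) || (perms38.any fun p => isIso p l masks38)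

theorem search_six :
    addAll false (search false known 20) [195, 198, 204, 216, 240, 225] [] 0 0 = true := by
  decide +kernel

theorem search_five :
    addAll true (search true known 20) [195, 198, 204, 216, 209] [] 0 0 = true := by
  decide +kernel

/-! ### Isomorphisms -/

section

/-- The set of labels described by the mask `m`. -/
def bits (m : ℕ) : Finset ℕ := (Finset.range 9).filter (m.testBit ·)

theorem testBit_relabel {f j : ℕ} (p : List ℕ) : ∀ i, (relabel f i p).testBit j = true ↔
    ∃ k, f.testBit (i + k) = true ∧ p[k]? = some j := by
  induction p with
  | nil => simp [relabel]
  | cons x p ih =>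
    intro i
    have hs : (∃ k, f.testBit (i + k) = true ∧ (x :: p)[k]? = some j) ↔
        (f.testBit i = true ∧ x = j) ∨ (relabel f (i + 1) p).testBit j = true := by
      rw [ih]
      constructor
      · rintro ⟨_ | k, h1, h2⟩
        · exact Or.inl ⟨h1, by simpa using h2⟩
        · exact Or.inr ⟨k, by rwa [add_right_comm], by simpa using h2⟩
      · rintro (⟨h1, rfl⟩ | ⟨k, h1, h2⟩)
        · exact ⟨0, h1, by simp⟩
        · exact ⟨k + 1, by rwa [← add_assoc, add_right_comm], by simpa using h2⟩
    rw [hs, relabel, has_eq]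
    cases f.testBit i <;> simp [testBit_single]

theorem testBit_foldr {t : ℕ} (m : List ℕ) :
    (m.foldr (fun f N => (single f).lor N) 0).testBit t = true ↔ t ∈ m := by
  induction m with
  | nil => simp
  | cons f m ih =>
    rw [List.foldr_cons, testBit_lor, Bool.or_eq_true, ih, testBit_single, decide_eq_true_eq,
      List.mem_cons, eq_comm]

variable {α : Type*} {K : Complex α}

theorem image_eq_genCx (hK : IsComplex K) (hp : IsPure K 3) (φ : α → ℕ) :
    K.image (fun σ => σ.image φ) = genCx ((facets K 3).image fun σ => σ.image φ) := by
  ext τ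
  simp only [genCx, Finset.mem_image, Finset.mem_biUnion, Finset.mem_filter, Finset.mem_powerset]
  constructor
  · rintro ⟨σ, hσ, rfl⟩
    obtain ⟨ρ, h1, h2, h3⟩ := hp σ hσ
    exact ⟨_, ⟨ρ, mem_facets.2 ⟨h1, h3⟩, rfl⟩, Finset.image_subset_image h2,
      (hK.2.1 σ hσ).image φ⟩
  · rintro ⟨_, ⟨ρ, hρ, rfl⟩, h1, h2⟩
    obtain ⟨σ, hσ, rfl⟩ := Finset.subset_image_iff.1 h1
    exact ⟨σ, hK.2.2 ρ (mem_facets.1 hρ).1 σ hσ (Finset.image_nonempty.1 h2), rfl⟩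

/-- The list `p` consists of different labels for the vertices `0, …, 7`. -/
def IsRelabelling (p : List ℕ) : Prop := p.length = 8 ∧ p.Nodup ∧ ∀ j ∈ p, j < 9

instance : DecidablePred IsRelabelling := fun _ => inferInstanceAs (Decidable (_ ∧ _))

variable [DecidableEq α] {e : ℕ → α}

theorem Labelling.iso (he : Labelling (verts K) e) (hK : IsComplex K) (hp : IsPure K 3)
    {l p m : List ℕ} (hl : ∀ f, f < 256 ∧ unmask e f ∈ facets K 3 ↔ f ∈ l)
    (hr : IsRelabelling p) (h : isIso p l m = true) : Iso K (genCx (m.map bits).toFinset) := by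
  obtain ⟨g, hg⟩ : ∃ g : α → ℕ, ∀ i < 8, g (e i) = i :=
    ⟨Function.invFunOn e {i | i < 8}, fun i hi => Set.InjOn.leftInvOn_invFunOn
      (fun i hi j hj => he.inj i hi j hj) hi⟩
  obtain ⟨hr1, hr2, hr3⟩ := hr
  have hφ : ∀ k < 8, p[k]? = some (p.getD (g (e k)) 0) := fun k hk => by
    have hk' : k < p.length := by omega
    rw [hg k hk, List.getD_eq_getElem _ _ hk', List.getElem?_eq_getElem hk']
  set φ : α → ℕ := fun a => p.getD (g a) 0 with hφd
  have hbits : ∀ f, (unmask e f).image φ = bits (relabel f 0 p) := by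
    intro f
    ext j
    simp only [bits, Finset.mem_image, Finset.mem_filter, Finset.mem_range, testBit_relabel,
      zero_add, mem_unmask]
    constructor
    · rintro ⟨_, ⟨k, hk, hf, rfl⟩, rfl⟩
      exact ⟨hr3 _ (List.mem_of_getElem? (hφ k hk)), k, hf, hφ k hk⟩
    · rintro ⟨-, k, hf, hkj⟩
      have hk : k < 8 := hr1 ▸ (List.getElem?_eq_some_iff.1 hkj).1
      exact ⟨e k, ⟨k, hk, hf, rfl⟩, Option.some_injective _ ((hφ k hk).symm.trans hkj)⟩
  simp only [isIso, force_eq, Bool.and_eq_true, List.all_eq_true, List.any_eq_true, has_eq,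
    testBit_foldr, Nat.beq_eq] at h
  refine ⟨φ, ?_, ?_⟩
  · intro x hx y hy hxy
    obtain ⟨i, hi, rfl⟩ := (he.mem_iff x).1 hx
    obtain ⟨j, hj, rfl⟩ := (he.mem_iff y).1 hy
    have : p[i]? = p[j]? := by rw [hφ i hi, hφ j hj]; exact congrArg some hxy
    rw [(List.getElem?_inj (by omega) hr2).1 this]
  · rw [image_eq_genCx hK hp]
    congr 1
    ext τ
    simp only [List.mem_toFinset, List.mem_map, Finset.mem_image]
    constructor
    · rintro ⟨t, ht, rfl⟩
      obtain ⟨f, hf, rfl⟩ := h.2 t ht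
      exact ⟨_, ((hl f).2 hf).2, hbits f⟩
    · rintro ⟨σ, hσ, rfl⟩
      obtain ⟨f, hf, rfl⟩ := he.exists_unmask (fun x hx =>
        mem_verts.2 ⟨σ, (mem_facets.1 hσ).1, hx⟩)
      exact ⟨_, h.1 f ((hl f).1 ⟨hf, hσ⟩), (hbits f).symm⟩

theorem S35_eq : S35 = genCx (masks35.map bits).toFinset := by
  unfold S35; congr 1; decide +kernel

theorem S36_eq : S36 = genCx (masks36.map bits).toFinset := by
  unfold S36; congr 1; decide +kernel

theorem S37_eq : S37 = genCx (masks37.map bits).toFinset := by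
  unfold S37; congr 1; decide +kernel

theorem S38_eq : S38 = genCx (masks38.map bits).toFinset := by
  unfold S38; congr 1; decide +kernel

theorem Labelling.iso_of_known (he : Labelling (verts K) e) (hK : IsComplex K) (hp : IsPure K 3)
    {l : List ℕ} (hl : ∀ f, f < 256 ∧ unmask e f ∈ facets K 3 ↔ f ∈ l) (h : known l = true) :
    Iso K S35 ∨ Iso K S36 ∨ Iso K S37 ∨ Iso K S38 := by
  have h35 : ∀ p ∈ perms35, IsRelabelling p := by decide +kernel
  have h36 : ∀ p ∈ perms36, IsRelabelling p := by decide +kernel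
  have h37 : ∀ p ∈ perms37, IsRelabelling p := by decide +kernel
  have h38 : ∀ p ∈ perms38, IsRelabelling p := by decide +kernel
  simp only [known, Bool.or_eq_true, List.any_eq_true, or_assoc] at h
  rw [S35_eq, S36_eq, S37_eq, S38_eq]
  rcases h with ⟨p, h1, h2⟩ | ⟨p, h1, h2⟩ | ⟨p, h1, h2⟩ | ⟨p, h1, h2⟩
  · exact Or.inl (he.iso hK hp hl (h35 p h1) h2)
  · exact Or.inr (Or.inl (he.iso hK hp hl (h36 p h1) h2))
  · exact Or.inr (Or.inr (Or.inl (he.iso hK hp hl (h37 p h1) h2)))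
  · exact Or.inr (Or.inr (Or.inr (he.iso hK hp hl (h38 p h1) h2)))

theorem labelling_of_list {V : Finset α} {L : List α} (hn : L.Nodup) (h8 : L.length = 8)
    (hV : V.card = 8) (hL : ∀ x ∈ L, x ∈ V) (d : α) : Labelling V fun i => L.getD i d where
  inj i hi j hj h := by
    rw [List.getD_eq_getElem _ _ (by omega), List.getD_eq_getElem _ _ (by omega)] at h
    exact (hn.getElem_inj_iff).1 h
  mem_iff x := by
    have : L.toFinset = V := Finset.eq_of_subset_of_card_le
      (fun x hx => hL x (List.mem_toFinset.1 hx))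
      (by rw [List.toFinset_card_of_nodup hn, hV, h8])
    rw [← this, List.mem_toFinset, List.mem_iff_getElem]
    constructor
    · rintro ⟨i, hi, rfl⟩
      exact ⟨i, by omega, List.getD_eq_getElem _ _ hi⟩
    · rintro ⟨i, hi, rfl⟩
      exact ⟨i, by omega, (List.getD_eq_getElem _ _ (by omega)).symm⟩

theorem unmask_eq {m : ℕ} {b : List ℕ} (h : (Finset.range 8).filter (m.testBit ·) = b.toFinset) :
    unmask e m = (b.map e).toFinset := by
  rw [unmask, h]
  ext
  simp

theorem iso_of_search (T : Triangulation (verts K) (facets K 3)) (hK : IsComplex K)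
    (hp : IsPure K 3) (he : Labelling (verts K) e) {six : Bool} {n : ℕ} {m : List ℕ}
    (h6 : six = true → ∀ x ∈ verts K, ∀ y ∈ verts K, x ≠ y →
      ∃ w ∈ verts K, w ≠ x ∧ w ≠ y ∧ ∀ σ ∈ facets K 3, x ∈ σ → y ∈ σ → w ∉ σ)
    (hm : ∀ f ∈ m, f < 256 ∧ unmask e f ∈ facets K 3) (hn : m.Nodup) (h0 : m ≠ [])
    (h : addAll six (search six known n) m [] 0 0 = true) :
    Iso K S35 ∨ Iso K S36 ∨ Iso K S37 ∨ Iso K S38 := by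
  obtain ⟨l, hl, hF⟩ := exists_list_of_addAll (he.model T h6) hm hn h0 h
  exact he.iso_of_known hK hp hF hl

theorem iso_of_six_cycle (T : Triangulation (verts K) (facets K 3)) (hK : IsComplex K)
    (hp : IsPure K 3) (h8 : (verts K).card = 8) {x y c₀ c₁ c₂ c₃ c₄ c₅ : α} (hxy : x ≠ y)
    (hn : [c₀, c₁, c₂, c₃, c₄, c₅].Nodup) (h₀ : {x, y, c₀, c₁} ∈ facets K 3)
    (h₁ : {x, y, c₁, c₂} ∈ facets K 3) (h₂ : {x, y, c₂, c₃} ∈ facets K 3)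
    (h₃ : {x, y, c₃, c₄} ∈ facets K 3) (h₄ : {x, y, c₄, c₅} ∈ facets K 3)
    (h₅ : {x, y, c₅, c₀} ∈ facets K 3) :
    Iso K S35 ∨ Iso K S36 ∨ Iso K S37 ∨ Iso K S38 := by
  have n₀ := ne_of_card_four (T.card_eq _ h₀)
  have n₂ := ne_of_card_four (T.card_eq _ h₂)
  have n₄ := ne_of_card_four (T.card_eq _ h₄)
  have s₀ := T.subset _ h₀
  have s₂ := T.subset _ h₂
  have s₄ := T.subset _ h₄
  simp only [Finset.insert_subset_iff, Finset.singleton_subset_iff] at s₀ s₂ s₄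
  have hL : [c₀, c₁, c₂, c₃, c₄, c₅, x, y].Nodup := by
    simp only [List.nodup_cons, List.mem_cons, List.not_mem_nil, or_false, not_or] at hn ⊢
    tauto
  have he := labelling_of_list hL rfl h8 (by simp; tauto) x
  refine iso_of_search T hK hp he (by simp) ?_ (by decide) (by simp) search_six
  simp only [List.forall_mem_cons, List.not_mem_nil, false_implies, implies_true, and_true]
  refine ⟨⟨by norm_num, ?_⟩, ⟨by norm_num, ?_⟩, ⟨by norm_num, ?_⟩, ⟨by norm_num, ?_⟩,
    ⟨by norm_num, ?_⟩, ⟨by norm_num, ?_⟩⟩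
  · rw [unmask_eq (b := [6, 7, 0, 1]) (by decide)]; simpa using h₀
  · rw [unmask_eq (b := [6, 7, 1, 2]) (by decide)]; simpa using h₁
  · rw [unmask_eq (b := [6, 7, 2, 3]) (by decide)]; simpa using h₂
  · rw [unmask_eq (b := [6, 7, 3, 4]) (by decide)]; simpa using h₃
  · rw [unmask_eq (b := [6, 7, 4, 5]) (by decide)]; simpa using h₄
  · rw [unmask_eq (b := [6, 7, 5, 0]) (by decide)]; simpa using h₅

theorem iso_of_five_cycle (T : Triangulation (verts K) (facets K 3)) (hK : IsComplex K)
    (hp : IsPure K 3) (h8 : (verts K).card = 8)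
    (h6 : ∀ x ∈ verts K, ∀ y ∈ verts K, x ≠ y →
      ∃ w ∈ verts K, w ≠ x ∧ w ≠ y ∧ ∀ σ ∈ facets K 3, x ∈ σ → y ∈ σ → w ∉ σ)
    {x y c₀ c₁ c₂ c₃ c₄ : α} (hxy : x ≠ y)
    (hn : [c₀, c₁, c₂, c₃, c₄].Nodup) (h₀ : {x, y, c₀, c₁} ∈ facets K 3)
    (h₁ : {x, y, c₁, c₂} ∈ facets K 3) (h₂ : {x, y, c₂, c₃} ∈ facets K 3)
    (h₃ : {x, y, c₃, c₄} ∈ facets K 3) (h₄ : {x, y, c₄, c₀} ∈ facets K 3) :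
    Iso K S35 ∨ Iso K S36 ∨ Iso K S37 ∨ Iso K S38 := by
  have n₀ := ne_of_card_four (T.card_eq _ h₀)
  have n₂ := ne_of_card_four (T.card_eq _ h₂)
  have n₄ := ne_of_card_four (T.card_eq _ h₄)
  have s₀ := T.subset _ h₀
  have s₂ := T.subset _ h₂
  have s₄ := T.subset _ h₄
  simp only [Finset.insert_subset_iff, Finset.singleton_subset_iff] at s₀ s₂ s₄
  obtain ⟨w, hw, hw'⟩ := Finset.exists_mem_notMem_of_card_lt_card
    (s := [c₀, c₁, c₂, c₃, c₄, x, y].toFinset) (t := verts K)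
    (by rw [h8]; exact (List.toFinset_card_le _).trans_lt (by simp))
  have hL : [c₀, c₁, c₂, c₃, c₄, w, x, y].Nodup := by
    simp only [List.nodup_cons, List.mem_cons, List.not_mem_nil, or_false, not_or,
      List.mem_toFinset] at hn hw' ⊢
    grind
  have he := labelling_of_list hL rfl h8 (by simp; tauto) x
  refine iso_of_search T hK hp he (fun _ => h6) ?_ (by decide) (by simp) search_five
  simp only [List.forall_mem_cons, List.not_mem_nil, false_implies, implies_true, and_true]
  refine ⟨⟨by norm_num, ?_⟩, ⟨by norm_num, ?_⟩, ⟨by norm_num, ?_⟩, ⟨by norm_num, ?_⟩,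
    ⟨by norm_num, ?_⟩⟩
  · rw [unmask_eq (b := [6, 7, 0, 1]) (by decide)]; simpa using h₀
  · rw [unmask_eq (b := [6, 7, 1, 2]) (by decide)]; simpa using h₁
  · rw [unmask_eq (b := [6, 7, 2, 3]) (by decide)]; simpa using h₂
  · rw [unmask_eq (b := [6, 7, 3, 4]) (by decide)]; simpa using h₃
  · rw [unmask_eq (b := [6, 7, 4, 0]) (by decide)]; simpa using h₄

theorem _root_.NPM.Comb3Mfd.iso (h : Comb3Mfd K) (hN : Neighbourly K)
    (h8 : (verts K).card = 8) : Iso K S35 ∨ Iso K S36 ∨ Iso K S37 ∨ Iso K S38 := by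
  have T := h.triangulation hN h8
  have hW : ∀ x ∈ verts K, ∀ y ∈ verts K, x ≠ y → (((verts K).erase x).erase y).card = 6 := by
    intro x hx y hy hxy
    rw [Finset.card_erase_of_mem (Finset.mem_erase.2 ⟨hxy.symm, hy⟩), Finset.card_erase_of_mem hx,
      h8]
  have hcyc := fun x hx y hy hxy => (T.cycleRel hx hy hxy).exists_cycle (hW x hx y hy hxy)
    (T.touched_subset x y) (fun a => T.mem_touched_iff hxy)
  by_cases H : ∃ x ∈ verts K, ∃ y ∈ verts K, x ≠ y ∧ (touched (facets K 3) x y).card = 6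
  · obtain ⟨x, hx, y, hy, hxy, hc⟩ := H
    obtain ⟨c₀, c₁, c₂, c₃, c₄, c₅, hn, h₀, h₁, h₂, h₃, h₄, h₅⟩ |
      ⟨c₀, c₁, c₂, c₃, c₄, hn, h₀, h₁, h₂, h₃, h₄, h₅⟩ := hcyc x hx y hy hxy (by omega)
    · exact iso_of_six_cycle T h.isComplex h.1.1.2.1 h8 hxy hn h₀ h₁ h₂ h₃ h₄ h₅
    · omega
  · obtain ⟨x, hx, y, hy, hxy, hc⟩ := T.exists_five_le h8
    obtain ⟨c₀, c₁, c₂, c₃, c₄, c₅, hn, h₀, h₁, h₂, h₃, h₄, h₅⟩ |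
      ⟨c₀, c₁, c₂, c₃, c₄, hn, h₀, h₁, h₂, h₃, h₄, -⟩ := hcyc x hx y hy hxy hc
    · exact iso_of_six_cycle T h.isComplex h.1.1.2.1 h8 hxy hn h₀ h₁ h₂ h₃ h₄ h₅
    · refine iso_of_five_cycle T h.isComplex h.1.1.2.1 h8 ?_ hxy hn h₀ h₁ h₂ h₃ h₄
      intro x hx y hy hxy
      obtain ⟨w, hw, hw'⟩ := Finset.exists_of_ssubset ((T.touched_subset x y).ssubset_of_ne
        fun e => H ⟨x, hx, y, hy, hxy, by rw [e, hW x hx y hy hxy]⟩)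
      rw [Finset.mem_erase, Finset.mem_erase] at hw
      exact ⟨w, hw.2.2, hw.2.1, hw.1, fun σ hσ hxσ hyσ hwσ =>
        hw' (mem_touched.2 ⟨⟨σ, hσ, hxσ, hyσ, hwσ⟩, hw.2.1, hw.1⟩)⟩

end

end NPM.Search

/-- every neighbourly combinatorial 3-manifold on 8 vertices is
isomorphic to `S^3_{8,35}`, `S^3_{8,36}`, `S^3_{8,37}` or `S^3_{8,38}`. -/
theorem statement11 {α : Type u} [DecidableEq α] (K : NPM.Complex α)
    (h1 : NPM.Comb3Mfd K) (h2 : NPM.Neighbourly K)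
    (h3 : (NPM.verts K).card = 8) :
    NPM.Iso K S35 ∨ NPM.Iso K S36 ∨ NPM.Iso K S37 ∨ NPM.Iso K S38 := by
  exact h1.iso h2 h3
end
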